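/- arXiv:1703.01207 — 2 statements merged into one kernel-verified Lean document; each statement's English description precedes it below -/
import Mathlib

section
/- Let (p_n) be a sequence in [0,1] satisfying n·p_n − log n − log log n → ∞ and n²(1 − p_n) → ∞ as n → ∞, and let G ∼ 𝒢(n, p_n). Then asymptotically almost surely the right-angled Coxeter group K(G) virtually algebraically fibers. -/
open MeasureTheory Filter

/-- Bernoulli measure on `Bool` with success probability `p`. -/
noncomputable def bernoulliMeasure (p : ℝ) : Measure Bool :=
  ENNReal.ofReal p • Measure.dirac true + ENNReal.ofReal (1 - p) • Measure.dirac false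

/-- The Erdős–Rényi measure `𝒢(n,p)`: the product over all (unordered) vertex pairs of
Bernoulli(p) indicators. -/
noncomputable def erdosRenyi (n : ℕ) (p : ℝ) : Measure (Sym2 (Fin n) → Bool) :=
  Measure.pi fun _ => bernoulliMeasure p

/-- The simple graph on `{1,…,n}` determined by an indicator `ω` of the edges. -/
def graphOf {n : ℕ} (ω : Sym2 (Fin n) → Bool) : SimpleGraph (Fin n) where
  Adj u v := u ≠ v ∧ ω s(u, v) = true
  symm := by
    constructor
    intro u v h
    exact ⟨h.1.symm, by rw [Sym2.eq_swap]; exact h.2⟩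
  loopless := ⟨fun v h => h.1 rfl⟩

instance {n : ℕ} (ω : Sym2 (Fin n) → Bool) : DecidableRel (graphOf ω).Adj :=
  fun u v => inferInstanceAs (Decidable (u ≠ v ∧ ω s(u, v) = true))

/-- The defining relations of the right-angled Coxeter group of a graph `G`:
`x_v² = 1` for every vertex `v`, and `(x_u x_v)² = 1` for every edge `{u,v}`. -/
def racgRels {V : Type*} (G : SimpleGraph V) : Set (FreeGroup V) :=
  {r | (∃ v : V, r = FreeGroup.of v * FreeGroup.of v) ∨
    (∃ u v : V, G.Adj u v ∧ r = (FreeGroup.of u * FreeGroup.of v) ^ 2)}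

/-- The right-angled Coxeter group associated to the graph `G`. -/
abbrev RACG {V : Type*} (G : SimpleGraph V) : Type _ :=
  PresentedGroup (racgRels G)

/-- A group `K` virtually algebraically fibers if some finite-index subgroup admits a
surjective homomorphism onto `ℤ` with finitely generated kernel. -/
def VirtuallyAlgebraicallyFibers (K : Type*) [Group K] : Prop :=
  ∃ K' : Subgroup K, K'.index ≠ 0 ∧
    ∃ φ : K' →* Multiplicative ℤ, Function.Surjective φ ∧ φ.ker.FG


namespace RFib

section grp
variable {V : Type*} {G : SimpleGraph V}

/-- generators -/
def xg (G : SimpleGraph V) (v : V) : RACG G := PresentedGroup.of v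

lemma xg_mul_self (v : V) : xg G v * xg G v = 1 := by
  have : (PresentedGroup.mk (racgRels G)) (FreeGroup.of v * FreeGroup.of v) = 1 :=
    PresentedGroup.one_of_mem (Or.inl ⟨v, rfl⟩)
  simpa [xg, PresentedGroup.of] using this

lemma xg_inv (v : V) : (xg G v)⁻¹ = xg G v :=
  inv_eq_of_mul_eq_one_left (xg_mul_self v)

lemma xg_mul_cancel (w : RACG G) (v : V) : w * xg G v * xg G v = w := by
  rw [mul_assoc, xg_mul_self, mul_one]

lemma xg_comm {u v : V} (h : G.Adj u v) : xg G u * xg G v = xg G v * xg G u := by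
  have : (PresentedGroup.mk (racgRels G)) ((FreeGroup.of u * FreeGroup.of v) ^ 2) = 1 :=
    PresentedGroup.one_of_mem (Or.inr ⟨u, v, h, rfl⟩)
  have h2 : (xg G u * xg G v) * (xg G u * xg G v) = 1 := by
    simpa [xg, PresentedGroup.of, pow_two] using this
  have h3 := eq_inv_of_mul_eq_one_left h2
  rw [h3, mul_inv_rev, xg_inv, xg_inv]

/-- subgroup generated by a vertex set -/
def sub (G : SimpleGraph V) (A : Set V) : Subgroup (RACG G) := Subgroup.closure (xg G '' A)

lemma xg_mem_sub {A : Set V} {v : V} (h : v ∈ A) : xg G v ∈ sub G A :=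
  Subgroup.subset_closure ⟨v, h, rfl⟩

lemma sub_mono {A B : Set V} (h : A ⊆ B) : sub G A ≤ sub G B :=
  Subgroup.closure_mono (Set.image_mono h)

lemma sub_induction {A : Set V} {p : RACG G → Prop} (one : p 1)
    (mul : ∀ w, ∀ v ∈ A, p w → p (w * xg G v)) {g : RACG G} (hg : g ∈ sub G A) : p g := by
  induction hg using Subgroup.closure_induction_right with
  | one => exact one
  | mul_right x _ y hy ih => obtain ⟨v, hv, rfl⟩ := hy; exact mul _ _ hv ih
  | mul_inv_cancel x _ y hy ih =>
    obtain ⟨v, hv, rfl⟩ := hy; rw [xg_inv]; exact mul _ _ hv ih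

lemma sub_univ : sub G Set.univ = ⊤ := by
  rw [sub, Set.image_univ]; exact PresentedGroup.closure_range_of _

lemma racg_induction {p : RACG G → Prop} (one : p 1)
    (mul : ∀ w v, p w → p (w * xg G v)) (g : RACG G) : p g :=
  sub_induction (A := Set.univ) one (fun w v _ => mul w v) (by rw [sub_univ]; trivial)

/-- connectivity in a region -/
def Conn (C : Set V) (S : Set (RACG G)) : RACG G → RACG G → Prop :=
  Relation.ReflTransGen (fun w w' => w ∈ S ∧ w' ∈ S ∧ ∃ v ∈ C, w' = w * xg G v)

lemma Conn.symm {C : Set V} {S : Set (RACG G)} {u w : RACG G} (h : Conn C S u w) :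
    Conn C S w u := by
  induction h with
  | refl => exact Relation.ReflTransGen.refl
  | tail _ hbc ih =>
    obtain ⟨ha, hb, v, hv, rfl⟩ := hbc
    exact Relation.ReflTransGen.head ⟨hb, ha, v, hv, (xg_mul_cancel _ _).symm⟩ ih

lemma Conn.mono {C C' : Set V} {S S' : Set (RACG G)} (hC : C ⊆ C') (hS : S ⊆ S') {u w : RACG G}
    (h : Conn C S u w) : Conn C' S' u w := by
  induction h with
  | refl => exact Relation.ReflTransGen.refl
  | tail _ hbc ih =>
    obtain ⟨ha, hb, v, hv, rfl⟩ := hbc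
    exact Relation.ReflTransGen.tail ih ⟨hS ha, hS hb, v, hC hv, rfl⟩

lemma Conn.trans {C : Set V} {S : Set (RACG G)} {u v w : RACG G} (h : Conn C S u v)
    (h' : Conn C S v w) : Conn C S u w := Relation.ReflTransGen.trans h h'

lemma Conn.step {C : Set V} {S : Set (RACG G)} {w : RACG G} {v : V} (hv : v ∈ C) (h : w ∈ S)
    (h' : w * xg G v ∈ S) : Conn C S w (w * xg G v) :=
  Relation.ReflTransGen.single ⟨h, h', v, hv, rfl⟩

/-- lowering the top level -/
lemma lower_top {C : Set V} (f : RACG G → ℤ)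
    (hstep : ∀ w, ∀ c ∈ C, f (w * xg G c) = f w + 1 ∨ f (w * xg G c) = f w - 1)
    (hlink : ∀ w, ∀ c ∈ C, ∀ c' ∈ C, f (w * xg G c) = f w - 1 → f (w * xg G c') = f w - 1 →
      Conn C {y | f w - 2 ≤ f y ∧ f y ≤ f w - 1} (w * xg G c) (w * xg G c'))
    {l m : ℤ} (hlm : l + 1 ≤ m) {u u' : RACG G} (hu : f u ≤ m)
    (h : Conn C {y | l ≤ f y ∧ f y ≤ m + 1} u u') :
    (f u' ≤ m → Conn C {y | l ≤ f y ∧ f y ≤ m} u u') ∧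
    (f u' = m + 1 → ∀ c ∈ C, f (u' * xg G c) = f u' - 1 →
      Conn C {y | l ≤ f y ∧ f y ≤ m} u (u' * xg G c)) := by
  induction h with
  | refl => exact ⟨fun _ => Relation.ReflTransGen.refl, fun h => by omega⟩
  | @tail y y' hy hyy' ih =>
    obtain ⟨hyS, hyS', c, hc, rfl⟩ := hyy'
    simp only [Set.mem_ofPred_eq] at hyS hyS'
    have hs := hstep y c hc
    constructor
    · intro hle
      rcases lt_or_ge m (f y) with h1 | h1
      · exact ih.2 (by omega) c hc (by omega)
      · exact (ih.1 h1).trans (Conn.step hc ⟨hyS.1, h1⟩ ⟨hyS'.1, hle⟩)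
    · intro heq c' hc' hd
      have h1 : f y ≤ m := by omega
      refine (ih.1 h1).trans ?_
      have h2 := hlink (y * xg G c) c hc c' hc' (by rw [xg_mul_cancel]; omega) hd
      rw [xg_mul_cancel] at h2
      refine h2.mono subset_rfl ?_
      rintro z ⟨hz1, hz2⟩
      exact ⟨by omega, by omega⟩

lemma lower_top_many {C : Set V} (f : RACG G → ℤ)
    (hstep : ∀ w, ∀ c ∈ C, f (w * xg G c) = f w + 1 ∨ f (w * xg G c) = f w - 1)
    (hlink : ∀ w, ∀ c ∈ C, ∀ c' ∈ C, f (w * xg G c) = f w - 1 → f (w * xg G c') = f w - 1 →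
      Conn C {y | f w - 2 ≤ f y ∧ f y ≤ f w - 1} (w * xg G c) (w * xg G c'))
    {l m : ℤ} (hlm : l + 1 ≤ m) {u u' : RACG G} (hu : f u ≤ m) (hu' : f u' ≤ m) (j : ℕ)
    (h : Conn C {y | l ≤ f y ∧ f y ≤ m + j} u u') :
    Conn C {y | l ≤ f y ∧ f y ≤ m} u u' := by
  induction j with
  | zero => simpa using h
  | succ j ih =>
    apply ih
    refine (lower_top f hstep hlink (l := l) (m := m + j) (by omega) (by omega) ?_).1 (by omega)
    refine h.mono subset_rfl ?_
    rintro z ⟨hz1, hz2⟩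
    push_cast at hz2
    exact ⟨by omega, by omega⟩

lemma conn_univ_of_sub {C : Set V} {u g : RACG G} (hg : g ∈ sub G C) :
    Conn C Set.univ u (u * g) := by
  refine sub_induction (p := fun g => Conn C Set.univ u (u * g)) ?_ ?_ hg
  · rw [mul_one]; exact Relation.ReflTransGen.refl
  · intro w v hv h
    rw [← mul_assoc]
    exact h.trans (Conn.step hv trivial trivial)

lemma conn_bounded (f : RACG G → ℤ) {C : Set V} {u u' : RACG G} (h : Conn C Set.univ u u') :
    ∃ j : ℕ, Conn C {y | - (j : ℤ) ≤ f y ∧ f y ≤ j} u u' := by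
  induction h with
  | refl => exact ⟨0, Relation.ReflTransGen.refl⟩
  | @tail y y' hy hyy' ih =>
    obtain ⟨-, -, c, hc, rfl⟩ := hyy'
    obtain ⟨j, hj⟩ := ih
    refine ⟨j + (f y).natAbs + (f (y * xg G c)).natAbs, ?_⟩
    refine Conn.trans (hj.mono subset_rfl ?_) (Conn.step hc ?_ ?_)
    · rintro z ⟨h1, h2⟩; constructor <;> omega
    · constructor <;> omega
    · constructor <;> omega

lemma slab_conn {C : Set V} (f : RACG G → ℤ)
    (hstep : ∀ w, ∀ c ∈ C, f (w * xg G c) = f w + 1 ∨ f (w * xg G c) = f w - 1)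
    (hlink : ∀ w, ∀ c ∈ C, ∀ c' ∈ C, f (w * xg G c) = f w - 1 → f (w * xg G c') = f w - 1 →
      Conn C {y | f w - 2 ≤ f y ∧ f y ≤ f w - 1} (w * xg G c) (w * xg G c'))
    (hlink' : ∀ w, ∀ c ∈ C, ∀ c' ∈ C, f (w * xg G c) = f w + 1 → f (w * xg G c') = f w + 1 →
      Conn C {y | f w + 1 ≤ f y ∧ f y ≤ f w + 2} (w * xg G c) (w * xg G c'))
    {l m : ℤ} (hlm : l + 1 ≤ m) {u g : RACG G} (hg : g ∈ sub G C)
    (hu : l ≤ f u ∧ f u ≤ m) (hu' : l ≤ f (u * g) ∧ f (u * g) ≤ m) :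
    Conn C {y | l ≤ f y ∧ f y ≤ m} u (u * g) := by
  obtain ⟨j, hj⟩ := conn_bounded f (conn_univ_of_sub (u := u) hg)
  have h1 : Conn C {y | l - (j + l.natAbs + m.natAbs : ℕ) ≤ f y ∧
      f y ≤ m + (j + l.natAbs + m.natAbs : ℕ)} u (u * g) := by
    refine hj.mono subset_rfl ?_
    rintro z ⟨h1, h2⟩; constructor <;> omega
  have h2 := lower_top_many f hstep hlink (by omega) hu.2 hu'.2 _ h1
  have h3 := lower_top_many (fun w => - f w) (C := C) (l := -m) (m := -l) (u := u) (u' := u * g)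
    (fun w c hc => by rcases hstep w c hc with h | h <;> omega)
    (fun w c hc c' hc' h h' => (hlink' w c hc c' hc' (by omega) (by omega)).mono subset_rfl
      (by rintro z ⟨h1, h2⟩; constructor <;> omega))
    (by omega) (by omega) (by omega) (j + l.natAbs + m.natAbs)
    (h2.mono subset_rfl (by rintro z ⟨h1, h2⟩; constructor <;> omega))
  exact h3.mono subset_rfl (by rintro z ⟨h1, h2⟩; constructor <;> omega)

/-- coarse goodness of a vertex set -/
def Good (h : RACG G → ℤ) (A : Set V) : Prop :=
  ∀ R : ℤ, ∃ r : ℤ, ∀ (t : ℤ) (u g : RACG G), g ∈ sub G A → |h u - t| ≤ R → |h (u * g) - t| ≤ R →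
    Conn Set.univ {y | |h y - t| ≤ r} u (u * g)

lemma good_insert {h : RACG G → ℤ} {A : Set V} (hA : Good h A) {v a b : V} (ha : a ∈ A)
    (hb : b ∈ A) (hva : G.Adj v a) (hvb : G.Adj v b) {B R0 : ℤ}
    (hB : ∀ w, |h (w * xg G v) - h w| ≤ B)
    (hR : ∀ w t, ∃ d ∈ sub G {a, b}, |h (w * d) - t| ≤ R0) : Good h (insert v A) := by
  have hcomm : ∀ d ∈ sub G ({a, b} : Set V), d * xg G v = xg G v * d := by
    intro d hd
    refine sub_induction (p := fun d => d * xg G v = xg G v * d) (by simp) ?_ hd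
    intro w c hc ih
    have : G.Adj v c := by rcases hc with rfl | rfl <;> assumption
    rw [mul_assoc, ← xg_comm this, ← mul_assoc, ih, mul_assoc]
  have hsub : sub G ({a, b} : Set V) ≤ sub G A := sub_mono (by
    rintro c (rfl | rfl) <;> assumption)
  have hB0 : 0 ≤ B := (abs_nonneg _).trans (hB 1)
  have hR0 : 0 ≤ R0 := by obtain ⟨d, -, hd⟩ := hR 1 0; exact (abs_nonneg _).trans hd
  intro R
  obtain ⟨r, hr⟩ := hA (|R| + R0 + B)
  refine ⟨max r (|R| + R0 + B), ?_⟩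
  intro t u g hg hu hug
  have hRabs := le_abs_self R
  have hRabs' := abs_nonneg R
  have key : ∀ d ∈ sub G ({a, b} : Set V), |h (u * g * d) - t| ≤ |R| + R0 + B →
      Conn Set.univ {y | |h y - t| ≤ max r (|R| + R0 + B)} u (u * g * d) := by
    have hr' : ∀ (u g : RACG G), g ∈ sub G A → |h u - t| ≤ |R| + R0 + B →
        |h (u * g) - t| ≤ |R| + R0 + B →
        Conn Set.univ {y | |h y - t| ≤ max r (|R| + R0 + B)} u (u * g) := fun u g h1 h2 h3 =>
      (hr t u g h1 h2 h3).mono (S' := {y | |h y - t| ≤ max r (|R| + R0 + B)}) subset_rfl (by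
        intro y hy
        exact le_trans (show |h y - t| ≤ r from hy) (le_max_left _ _))
    refine sub_induction (A := insert v A) (p := fun g => ∀ d ∈ sub G ({a, b} : Set V),
      |h (u * g * d) - t| ≤ |R| + R0 + B →
      Conn Set.univ {y | |h y - t| ≤ max r (|R| + R0 + B)} u (u * g * d)) ?_ ?_ hg
    · intro d hd hh
      rw [mul_one] at hh ⊢
      exact hr' u d (hsub hd) (by linarith) hh
    · intro w c hc ih d hd hh
      obtain ⟨d0, hd0, hd0'⟩ := hR (u * w) t
      have h1 := ih d0 hd0 (by linarith)
      refine h1.trans ?_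
      rcases hc with rfl | hc
      · have e1 : u * w * d0 * xg G c = u * (w * xg G c) * d0 := by
          simp only [mul_assoc]; rw [hcomm d0 hd0]
        have h2 : |h (u * (w * xg G c) * d0) - t| ≤ |R| + R0 + B := by
          rw [← e1]
          have := hB (u * w * d0)
          have h6 := abs_le.1 this
          have h7 := abs_le.1 hd0'
          refine abs_le.2 ⟨?_, ?_⟩ <;> linarith [h6.1, h6.2, h7.1, h7.2]
        have h3 : Conn Set.univ {y | |h y - t| ≤ max r (|R| + R0 + B)} (u * w * d0)
            (u * (w * xg G c) * d0) := by
          rw [← e1]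
          refine Conn.step trivial ?_ ?_
          · have h5 : |h (u * w * d0) - t| ≤ |R| + R0 + B := by linarith
            exact le_trans h5 (le_max_right _ _)
          · rw [e1]; exact h2.trans (le_max_right _ _)
        refine h3.trans ?_
        have e2 : u * (w * xg G c) * d = u * (w * xg G c) * d0 * (d0⁻¹ * d) := by group
        rw [e2] at hh ⊢
        exact hr' _ _ (hsub (mul_mem (inv_mem hd0) hd)) h2 hh
      · have e2 : u * (w * xg G c) * d = u * w * d0 * (d0⁻¹ * xg G c * d) := by group
        rw [e2] at hh ⊢
        exact hr' _ _ (mul_mem (mul_mem (inv_mem (hsub hd0)) (xg_mem_sub hc)) (hsub hd))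
          (by linarith) hh
  have := key 1 (one_mem _) (by rw [mul_one]; linarith)
  rwa [mul_one] at this

end grp

section fg
variable {V : Type*} [Finite V] {G : SimpleGraph V}

lemma fg_of_good (h : RACG G → ℤ) (K : Subgroup (RACG G)) [K.FiniteIndex]
    (hK : ∀ g ∈ K, ∀ w, h (g * w) = h g + h w) (hgood : Good h Set.univ) (N : Subgroup (RACG G))
    (hN : ∀ g, g ∈ N ↔ g ∈ K ∧ h g = 0) : N.FG := by
  classical
  obtain ⟨r, hr⟩ := hgood 0
  have h1 : h 1 = 0 := by have := hK 1 (one_mem _) 1; simp at this; exact this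
  have hinv : ∀ g ∈ K, h g⁻¹ = - h g := by
    intro g hg
    have := hK g hg g⁻¹
    rw [mul_inv_cancel, h1] at this
    omega
  -- classification map
  let Q := Quotient (QuotientGroup.rightRel K)
  have : Finite Q :=
    Finite.of_equiv _ (QuotientGroup.quotientRightRelEquivQuotientLeftRel K).symm
  let X : Set (RACG G) := {y | |h y - 0| ≤ r}
  let cl : RACG G → Q × ℤ := fun w => (Quotient.mk _ w, h w)
  have hcl : ∀ w w', cl w = cl w' → w' * w⁻¹ ∈ N := by
    intro w w' hw
    have e1 : w' * w⁻¹ ∈ K := by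
      have := (Prod.mk.injEq _ _ _ _ ▸ hw : _ ∧ _).1
      exact QuotientGroup.rightRel_apply.mp (Quotient.exact this)
    have e2 : h w = h w' := (Prod.mk.injEq _ _ _ _ ▸ hw : _ ∧ _).2
    refine (hN _).2 ⟨e1, ?_⟩
    have := hK _ e1 w
    rw [inv_mul_cancel_right] at this
    omega
  have hfin : (cl '' X).Finite := by
    refine Set.Finite.subset (Set.Finite.prod (Set.finite_univ (α := Q)) (Set.finite_Icc (-r) r)) ?_
    rintro _ ⟨w, hw, rfl⟩
    refine ⟨trivial, ?_⟩
    have : |h w - 0| ≤ r := hw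
    rw [abs_le] at this
    exact ⟨by simpa using this.1, by simpa using this.2⟩
  obtain ⟨F, hFX, hFfin, hFim⟩ : ∃ F : Set (RACG G), F ⊆ X ∧ F.Finite ∧ cl '' F = cl '' X := by
    obtain ⟨F, hF, hb⟩ := (Set.surjOn_image cl X).exists_bijOn_subset
    exact ⟨F, hF, hb.finite_iff_finite.2 hfin, hb.image_eq⟩
  have hrep : ∀ x ∈ X, ∃ f ∈ F, x * f⁻¹ ∈ N := by
    intro x hx
    have : cl x ∈ cl '' F := by rw [hFim]; exact ⟨x, hx, rfl⟩
    obtain ⟨f, hf, hfx⟩ := this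
    exact ⟨f, hf, hcl _ _ hfx⟩
  let T : Set (RACG G) := ((fun q : (RACG G × RACG G) × Option V =>
      q.1.1 * (q.2.elim 1 (xg G)) * q.1.2⁻¹) '' ((insert 1 F ×ˢ insert 1 F) ×ˢ Set.univ)) ∩ N
  have hT : T.Finite := by
    refine Set.Finite.inter_of_left ?_ _
    exact Set.Finite.image _ (((hFfin.insert 1).prod (hFfin.insert 1)).prod Set.finite_univ)
  refine (Subgroup.fg_iff N).2 ⟨T, le_antisymm ?_ ?_, hT⟩
  · rw [Subgroup.closure_le]; exact Set.inter_subset_right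
  · have hmem : ∀ f ∈ insert 1 F, ∀ f' ∈ insert 1 F, ∀ o : Option V,
        f * (o.elim 1 (xg G)) * f'⁻¹ ∈ N → f * (o.elim 1 (xg G)) * f'⁻¹ ∈ Subgroup.closure T := by
      intro f hf f' hf' o ho
      exact Subgroup.subset_closure ⟨⟨((f, f'), o), ⟨⟨hf, hf'⟩, trivial⟩, rfl⟩, ho⟩
    have key : ∀ x, Conn Set.univ X 1 x → ∃ f ∈ insert 1 F, x * f⁻¹ ∈ Subgroup.closure T := by
      intro x hx
      induction hx with
      | refl => exact ⟨1, Set.mem_insert _ _, by simp⟩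
      | @tail y y' hy hyy' ih =>
        obtain ⟨hyX, hyX', v, -, rfl⟩ := hyy'
        obtain ⟨f, hf, hfT⟩ := ih
        obtain ⟨f', hf', hfN⟩ := hrep _ hyX'
        refine ⟨f', Set.mem_insert_of_mem _ hf', ?_⟩
        have hTN : Subgroup.closure T ≤ N := by
          rw [Subgroup.closure_le]; exact Set.inter_subset_right
        have e : f * ((some v).elim 1 (xg G)) * f'⁻¹
            = (y * f⁻¹)⁻¹ * (y * xg G v * f'⁻¹) := by simp; group
        have := hmem f hf f' (Set.mem_insert_of_mem _ hf') (some v) (by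
          rw [e]; exact mul_mem (inv_mem (hTN hfT)) hfN)
        rw [e] at this
        have := mul_mem hfT this
        rwa [mul_inv_cancel_left] at this
    intro g hg
    have hg0 := (hN g).1 hg
    have hc := hr 0 1 g (by rw [sub_univ]; trivial) (by simp [h1]) (by simp [hg0.2])
    rw [one_mul] at hc
    obtain ⟨f, hf, hfT⟩ := key g hc
    have hTN : Subgroup.closure T ≤ N := by
      rw [Subgroup.closure_le]; exact Set.inter_subset_right
    have hfN : f ∈ N := by
      have := mul_mem (inv_mem (hTN hfT)) hg
      simpa using this
    have h2 := hmem f hf 1 (Set.mem_insert _ _) none (by simpa using hfN)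
    have := mul_mem hfT h2
    simpa using this

lemma fibers_of_good (h : RACG G → ℤ) (K : Subgroup (RACG G)) [hKf : K.FiniteIndex]
    (hK : ∀ g ∈ K, ∀ w, h (g * w) = h g + h w) (hgood : Good h Set.univ)
    (hunb : ∀ r : ℤ, ∃ w, r < h w) : VirtuallyAlgebraicallyFibers (RACG G) := by
  classical
  refine ⟨K, hKf.index_ne_zero, ?_⟩
  have h1 : h 1 = 0 := by have := hK 1 (one_mem _) 1; simp at this; exact this
  let φ : K →* Multiplicative ℤ :=
    { toFun := fun g => Multiplicative.ofAdd (h g)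
      map_one' := by simp [h1]
      map_mul' := fun a b => by simp [hK a a.2 b] }
  have hker : φ.ker.FG := by
    have h2 : (φ.ker.map K.subtype).FG := by
      refine fg_of_good h K hK hgood _ ?_
      intro g
      constructor
      · rintro ⟨k, hk, rfl⟩
        refine ⟨k.2, ?_⟩
        have : φ k = 1 := hk
        exact Multiplicative.ofAdd.injective this
      · rintro ⟨hg, h0⟩
        refine ⟨⟨g, hg⟩, ?_, rfl⟩
        change Multiplicative.ofAdd (h g) = 1
        rw [h0]; rfl
    rw [Subgroup.fg_iff_submonoid_fg] at h2 ⊢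
    exact Submonoid.FG.map_injective K.subtype Subtype.coe_injective h2
  have hnt : ∃ k : K, φ k ≠ 1 := by
    by_contra hcon
    push Not at hcon
    have hz : ∀ g ∈ K, h g = 0 := fun g hg => Multiplicative.ofAdd.injective (hcon ⟨g, hg⟩)
    have hfac : ∀ w w' : RACG G, QuotientGroup.rightRel K w w' → h w = h w' := by
      intro w w' hw
      have e1 := QuotientGroup.rightRel_apply.mp hw
      have := hK _ e1 w
      rw [inv_mul_cancel_right, hz _ e1] at this
      omega
    let Q := Quotient (QuotientGroup.rightRel K)
    have : Finite Q :=
      Finite.of_equiv _ (QuotientGroup.quotientRightRelEquivQuotientLeftRel K).symm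
    let hq : Q → ℤ := Quotient.lift h hfac
    obtain ⟨M, hM⟩ := (Set.finite_range hq).bddAbove
    obtain ⟨w, hw⟩ := hunb M
    have : h w ≤ M := hM ⟨Quotient.mk _ w, rfl⟩
    omega
  obtain ⟨k, hk⟩ := hnt
  have : Infinite φ.range := by
    have hne : (Multiplicative.toAdd (φ k)) ≠ 0 := fun h0 => hk (Multiplicative.toAdd.injective h0)
    refine Infinite.of_injective (fun m : ℕ => (⟨φ (k ^ m), ⟨_, rfl⟩⟩ : φ.range)) ?_
    intro m m' hmm
    have h3 : φ (k ^ m) = φ (k ^ m') := congrArg Subtype.val hmm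
    rw [map_pow, map_pow] at h3
    have h4 := congrArg Multiplicative.toAdd h3
    rw [toAdd_pow, toAdd_pow] at h4
    simp only [nsmul_eq_mul] at h4
    exact_mod_cast mul_right_cancel₀ hne h4
  let e : Multiplicative ℤ ≃* φ.range := intCyclicMulEquiv
  refine ⟨e.symm.toMonoidHom.comp φ.rangeRestrict, ?_, ?_⟩
  · exact e.symm.surjective.comp φ.rangeRestrict_surjective
  · have : (e.symm.toMonoidHom.comp φ.rangeRestrict).ker = φ.ker := by
      ext x
      simp [MonoidHom.mem_ker]
    rw [this]; exact hker

end fg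
end RFib

namespace RFib

/-- sign of a flip -/
def sg (b : Bool) (n : ℤ) : ℤ := if (b = true ↔ n % 2 = 0) then 1 else -1

lemma sg_cases (b : Bool) (n : ℤ) : (sg b n = 1 ∨ sg b n = -1) := by
  unfold sg; split_ifs <;> simp

lemma sg_flip (b b' : Bool) (n : ℤ) : sg b (n + sg b' n) = - sg b n := by
  cases b <;> cases b' <;> unfold sg <;> simp <;> split_ifs <;> omega

lemma sg_neg (n : ℤ) : sg false n = - sg true n := by
  unfold sg; simp; split_ifs <;> omega

lemma sg_add_even (b : Bool) (m n : ℤ) (hm : m % 2 = 0) : sg b (m + n) = sg b n := by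
  unfold sg
  have : (m + n) % 2 = n % 2 := by omega
  rw [this]

/-- flip permutation -/
def flipP (b : Bool) : Equiv.Perm ℤ :=
  Function.Involutive.toPerm (fun n => n + sg b n) (fun n => by
    change n + sg b n + sg b (n + sg b n) = n
    rw [sg_flip]; ring)

@[simp] lemma flipP_apply (b : Bool) (n : ℤ) : flipP b n = n + sg b n := rfl

lemma flipP_sq (b : Bool) : flipP b * flipP b = 1 := by
  ext n; simp [sg_flip]

section hts
variable {V ι : Type*} {G : SimpleGraph V}

open Classical in
/-- local permutation -/
noncomputable def pm (S : ι → Bool → Set V) (i : ι) (v : V) : Equiv.Perm ℤ :=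
  if v ∈ S i true then flipP true else if v ∈ S i false then flipP false else 1

open Classical in
/-- sign value -/
noncomputable def sv (S : ι → Bool → Set V) (i : ι) (v : V) : ℤˣ :=
  if v ∈ S i true then -1 else if v ∈ S i false then -1 else 1

/-- admissible families -/
structure Adm (G : SimpleGraph V) (S : ι → Bool → Set V) : Prop where
  disj : ∀ i v, v ∈ S i true → v ∉ S i false
  nadj : ∀ i u v, u ∈ S i true → v ∈ S i false → ¬ G.Adj u v

lemma pm_mem {S : ι → Bool → Set V} (hS : Adm G S) {i : ι} {b : Bool} {v : V} (h : v ∈ S i b) :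
    pm S i v = flipP b := by
  cases b
  · have : v ∉ S i true := fun h' => hS.disj i v h' h
    simp [pm, this, h]
  · simp [pm, h]

lemma pm_nmem {S : ι → Bool → Set V} {i : ι} {v : V} (h : ∀ b, v ∉ S i b) :
    pm S i v = 1 := by
  simp [pm, h]

lemma pm_sq (S : ι → Bool → Set V) (i : ι) (v : V) : pm S i v * pm S i v = 1 := by
  unfold pm; split_ifs <;> simp [flipP_sq]

lemma sv_sq (S : ι → Bool → Set V) (i : ι) (v : V) : sv S i v * sv S i v = 1 := by
  unfold sv; split_ifs <;> simp

lemma pm_rel {S : ι → Bool → Set V} (hS : Adm G S) (i : ι) :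
    ∀ r ∈ racgRels G, FreeGroup.lift (pm S i) r = 1 := by
  rintro r (⟨v, rfl⟩ | ⟨u, v, huv, rfl⟩)
  · simp [pm_sq]
  · simp only [map_pow, map_mul, FreeGroup.lift_apply_of]
    have h1 := pm_sq S i u
    have h2 := pm_sq S i v
    by_cases hu : ∃ b, u ∈ S i b
    · obtain ⟨b, hb⟩ := hu
      by_cases hv : ∃ b, v ∈ S i b
      · obtain ⟨b', hb'⟩ := hv
        have : b = b' := by
          cases b <;> cases b'
          · rfl
          · exact absurd huv.symm (hS.nadj i _ _ hb' hb)
          · exact absurd huv (hS.nadj i _ _ hb hb')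
          · rfl
        subst this
        rw [pm_mem hS hb, pm_mem hS hb', flipP_sq, one_pow]
      · push Not at hv
        rw [pm_nmem hv, mul_one, pow_two, h1]
    · push Not at hu
      rw [pm_nmem hu, one_mul, pow_two, h2]

/-- the action -/
noncomputable def rho {S : ι → Bool → Set V} (hS : Adm G S) (i : ι) : RACG G →* Equiv.Perm ℤ :=
  PresentedGroup.toGroup (pm_rel hS i)

/-- the parity map -/
noncomputable def par (G : SimpleGraph V) (S : ι → Bool → Set V) : RACG G →* (ι → ℤˣ) :=
  PresentedGroup.toGroup (f := fun v i => sv S i v) (by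
    rintro r (⟨v, rfl⟩ | ⟨u, v, huv, rfl⟩)
    · ext i
      simp
    · ext i
      simp only [map_pow, map_mul, FreeGroup.lift_apply_of]
      simp)

lemma par_x (S : ι → Bool → Set V) (v : V) : par G S (xg G v) = fun i => sv S i v :=
  PresentedGroup.toGroup.of _

/-- heights -/
noncomputable def hh {S : ι → Bool → Set V} (hS : Adm G S) (i : ι) (w : RACG G) : ℤ :=
  rho hS i w⁻¹ 0

lemma hh_one {S : ι → Bool → Set V} (hS : Adm G S) (i : ι) : hh hS i 1 = 0 := by
  simp [hh]

lemma hh_mul {S : ι → Bool → Set V} (hS : Adm G S) (i : ι) (w : RACG G) (v : V) :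
    hh hS i (w * xg G v) = pm S i v (hh hS i w) := by
  have : rho hS i (xg G v) = pm S i v := PresentedGroup.toGroup.of _
  rw [hh, mul_inv_rev, map_mul, xg_inv, this]; rfl

lemma hh_mem {S : ι → Bool → Set V} (hS : Adm G S) {i : ι} (w : RACG G) {v : V} {b : Bool}
    (h : v ∈ S i b) : hh hS i (w * xg G v) = hh hS i w + sg b (hh hS i w) := by
  rw [hh_mul, pm_mem hS h]; rfl

lemma hh_nmem {S : ι → Bool → Set V} (hS : Adm G S) {i : ι} (w : RACG G) {v : V}
    (h : ∀ b, v ∉ S i b) : hh hS i (w * xg G v) = hh hS i w := by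
  rw [hh_mul, pm_nmem h]; rfl

lemma hh_par {S : ι → Bool → Set V} (hS : Adm G S) (i : ι) (w : RACG G) :
    par G S w i = if hh hS i w % 2 = 0 then 1 else -1 := by
  induction w using racg_induction with
  | one => simp [hh_one]
  | mul w v ih =>
    rw [map_mul, par_x, Pi.mul_apply, ih]
    by_cases hv : ∃ b, v ∈ S i b
    · obtain ⟨b, hb⟩ := hv
      have h1 : sv S i v = -1 := by
        cases b <;> simp [sv, hb]
      rw [hh_mem hS w hb, h1]
      rcases sg_cases b (hh hS i w) with h | h <;> rw [h] <;> split_ifs <;> first | omega | simp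
    · push Not at hv
      have h1 : sv S i v = 1 := by simp [sv, hv]
      rw [hh_nmem hS w hv, h1, mul_one]

lemma hh_add {S : ι → Bool → Set V} (hS : Adm G S) (i : ι) {g : RACG G}
    (hg : g ∈ (par G S).ker) (w : RACG G) : hh hS i (g * w) = hh hS i g + hh hS i w := by
  have hev : hh hS i g % 2 = 0 := by
    by_contra hne
    have := hh_par hS i g
    rw [MonoidHom.mem_ker.1 hg, if_neg hne] at this
    simp at this
  induction w using racg_induction with
  | one => simp [hh_one]
  | mul w v ih =>
    rw [← mul_assoc]
    by_cases hv : ∃ b, v ∈ S i b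
    · obtain ⟨b, hb⟩ := hv
      rw [hh_mem hS _ hb, hh_mem hS _ hb, ih, sg_add_even _ _ _ hev, add_assoc]
    · push Not at hv
      rw [hh_nmem hS _ hv, hh_nmem hS _ hv, ih]

variable [Fintype ι]

/-- total height -/
noncomputable def ht {S : ι → Bool → Set V} (hS : Adm G S) (w : RACG G) : ℤ := ∑ i, hh hS i w

lemma ht_add {S : ι → Bool → Set V} (hS : Adm G S) {g : RACG G}
    (hg : g ∈ (par G S).ker) (w : RACG G) : ht hS (g * w) = ht hS g + ht hS w := by
  simp only [ht, hh_add hS _ hg, Finset.sum_add_distrib]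

lemma ht_bound {S : ι → Bool → Set V} (hS : Adm G S) (v : V) (w : RACG G) :
    |ht hS (w * xg G v) - ht hS w| ≤ Fintype.card ι := by
  rw [ht, ht, ← Finset.sum_sub_distrib]
  refine (Finset.abs_sum_le_sum_abs _ _).trans ?_
  refine (Finset.sum_le_card_nsmul _ _ 1 ?_).trans (by simp)
  intro i _
  by_cases hv : ∃ b, v ∈ S i b
  · obtain ⟨b, hb⟩ := hv
    rw [hh_mem hS _ hb]
    rcases sg_cases b (hh hS i w) with h | h <;> rw [h] <;> simp
  · push Not at hv
    rw [hh_nmem hS _ hv]; simp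

lemma ht_pair {S : ι → Bool → Set V} (hS : Adm G S) {i : ι} {a b : V} (e : Bool) (ha : a ∈ S i e)
    (hb : b ∈ S i (!e)) (hj : ∀ j, j ≠ i → (∀ c, a ∉ S j c) ∨ (∀ c, b ∉ S j c)) (w : RACG G) :
    ht hS (w * (xg G a * xg G b * xg G a * xg G b)) = ht hS w + 4 * sg e (hh hS i w) := by
  classical
  have h1 : ∀ j, hh hS j (w * (xg G a * xg G b * xg G a * xg G b))
      = hh hS j w + if j = i then 4 * sg e (hh hS i w) else 0 := by
    intro j
    have e1 : w * (xg G a * xg G b * xg G a * xg G b) =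
      w * xg G a * xg G b * xg G a * xg G b := by simp only [mul_assoc]
    rw [e1]
    by_cases hji : j = i
    · subst hji
      rw [if_pos rfl]
      set m := hh hS j w with hm
      have hs : ∀ n, sg (!e) n = - sg e n := by
        intro n; cases e <;> simp [sg_neg]
      have hs' : ∀ n, sg (!e) (n + sg e n) = sg e n := by
        intro n; rw [hs, sg_flip]; ring
      have hs2 : ∀ n, sg e (n + sg e n + sg e n) = sg e n := by
        intro n
        have h2 : n + sg e n + sg e n = 2 * sg e n + n := by ring
        rw [h2, sg_add_even _ _ _ (by omega)]
      have f1 := hh_mem hS w ha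
      have f2 := hh_mem hS (w * xg G a) hb
      have f3 := hh_mem hS (w * xg G a * xg G b) ha
      have f4 := hh_mem hS (w * xg G a * xg G b * xg G a) hb
      rw [f1, ← hm, hs'] at f2
      rw [f2, hs2] at f3
      have h5 := hs' (m + sg e m + sg e m)
      rw [hs2] at h5
      rw [f3, h5] at f4
      rw [f4]; ring
    · rw [if_neg hji, add_zero]
      simp only [hh_mul]
      have ea := fun n => congrArg (fun (f : Equiv.Perm ℤ) => f n) (pm_sq S j a)
      have eb := fun n => congrArg (fun (f : Equiv.Perm ℤ) => f n) (pm_sq S j b)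
      simp only [Equiv.Perm.mul_apply, Equiv.Perm.one_apply] at ea eb
      rcases hj j hji with h | h
      · simp only [pm_nmem h, Equiv.Perm.one_apply, eb]
      · simp only [pm_nmem h, Equiv.Perm.one_apply, ea]
  simp only [ht, h1, Finset.sum_add_distrib, Finset.sum_ite_eq', Finset.mem_univ, if_true]

lemma ht_reach {S : ι → Bool → Set V} (hS : Adm G S) {i : ι} {a b : V} (e : Bool) (ha : a ∈ S i e)
    (hb : b ∈ S i (!e)) (hj : ∀ j, j ≠ i → (∀ c, a ∉ S j c) ∨ (∀ c, b ∉ S j c)) (w : RACG G)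
    (t : ℤ) : ∃ d ∈ sub G {a, b}, |ht hS (w * d) - t| ≤ 4 := by
  have ham : xg G a ∈ sub G ({a, b} : Set V) := xg_mem_sub (by simp)
  have hbm : xg G b ∈ sub G ({a, b} : Set V) := xg_mem_sub (by simp)
  have m1 := mul_mem (mul_mem (mul_mem ham hbm) ham) hbm
  have m2 := mul_mem (mul_mem (mul_mem hbm ham) hbm) ham
  have hstep : ∀ w : RACG G, (∃ d ∈ sub G ({a, b} : Set V), ht hS (w * d) = ht hS w + 4) ∧
      (∃ d ∈ sub G ({a, b} : Set V), ht hS (w * d) = ht hS w - 4) := by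
    intro w
    have p1 := ht_pair hS e ha hb hj w
    have p2 := ht_pair hS (!e) (i := i) (a := b) (b := a) hb (by simpa using ha)
      (fun j h => (hj j h).symm) w
    have hs : sg (!e) (hh hS i w) = - sg e (hh hS i w) := by
        cases e <;> simp [sg_neg]
    rw [hs] at p2
    rcases sg_cases e (hh hS i w) with h | h <;> rw [h] at p1 p2
    · exact ⟨⟨_, m1, by rw [p1]; ring⟩, ⟨_, m2, by rw [p2]; ring⟩⟩
    · exact ⟨⟨_, m2, by rw [p2]; ring⟩, ⟨_, m1, by rw [p1]; ring⟩⟩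
  have hall : ∀ k : ℤ, ∃ d ∈ sub G ({a, b} : Set V), ht hS (w * d) = ht hS w + 4 * k := by
    intro k
    induction k using Int.induction_on with
    | zero => exact ⟨1, one_mem _, by simp⟩
    | succ k ih =>
      obtain ⟨d, hd, h⟩ := ih
      obtain ⟨d', hd', h'⟩ := (hstep (w * d)).1
      exact ⟨d * d', mul_mem hd hd', by rw [← mul_assoc, h', h]; ring⟩
    | pred k ih =>
      obtain ⟨d, hd, h⟩ := ih
      obtain ⟨d', hd', h'⟩ := (hstep (w * d)).2
      exact ⟨d * d', mul_mem hd hd', by rw [← mul_assoc, h', h]; ring⟩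
  obtain ⟨d, hd, h⟩ := hall ((t - ht hS w) / 4)
  refine ⟨d, hd, ?_⟩
  rw [h, abs_le]
  constructor <;> omega

end hts

/-- bipartite connectivity -/
def BipConn {V : Type*} (G : SimpleGraph V) (C D : Set V) : Prop :=
  ∀ X ⊆ C, ∀ Y ⊆ D, (X ∪ Y).Nonempty → (∀ x ∈ X, ∀ d ∈ D, G.Adj x d → d ∈ Y) →
    (∀ y ∈ Y, ∀ c ∈ C, G.Adj y c → c ∈ X) → X = C ∧ Y = D

/-- infection -/
inductive Inf {V : Type*} (G : SimpleGraph V) (Cs : Bool → Bool → Set V) (O : Set V) : V → Prop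
  | core {v : V} (s b : Bool) : v ∈ Cs s b → Inf G Cs O v
  | mid {v a b : V} : a ∈ Cs false true → b ∈ Cs false false → G.Adj v a → G.Adj v b → Inf G Cs O v
  | out {v a b : V} : a ∈ O → b ∈ O → a ≠ b → ¬ G.Adj a b → Inf G Cs O a → Inf G Cs O b →
      G.Adj v a → G.Adj v b → Inf G Cs O v

section thmD
variable {V : Type*} [Fintype V] [LinearOrder V] {G : SimpleGraph V}

/-- index type -/
abbrev Idx (G : SimpleGraph V) (O : Set V) : Type _ :=
  Bool ⊕ {q : V × V // q.1 < q.2 ∧ q.1 ∈ O ∧ q.2 ∈ O ∧ ¬ G.Adj q.1 q.2}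

/-- family -/
def fam (Cs : Bool → Bool → Set V) (O : Set V) : Idx G O → Bool → Set V
  | Sum.inl s, b => Cs s b
  | Sum.inr q, true => {q.1.1}
  | Sum.inr q, false => {q.1.2}

lemma fam_adm (Cs : Bool → Bool → Set V) (O : Set V)
    (hdisj : ∀ s v, v ∈ Cs s true → v ∉ Cs s false)
    (hno : ∀ s u v, u ∈ Cs s true → v ∈ Cs s false → ¬ G.Adj u v) :
    Adm G (fam (G := G) Cs O) := by
  constructor
  · rintro (s | ⟨⟨a, b⟩, hab, ha, hb, hn⟩) v h h'
    · exact hdisj s v h h'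
    · simp only [fam, Set.mem_singleton_iff] at h h'
      subst h; subst h'; exact lt_irrefl _ hab
  · rintro (s | ⟨⟨a, b⟩, hab, ha, hb, hn⟩) u v h h'
    · exact hno s u v h h'
    · simp only [fam, Set.mem_singleton_iff] at h h'
      subst h; subst h'; exact hn

open Classical in
theorem thmD (Cs : Bool → Bool → Set V) (O : Set V)
    (hdisj : ∀ s b s' b' v, v ∈ Cs s b → v ∈ Cs s' b' → s = s' ∧ b = b')
    (hO : ∀ s b v, v ∈ Cs s b → v ∉ O)
    (hno : ∀ s u v, u ∈ Cs s true → v ∈ Cs s false → ¬ G.Adj u v)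
    (hne : ∀ b, (Cs false b).Nonempty)
    (hbip : ∀ b b', BipConn G (Cs false b) (Cs true b'))
    (hinf : ∀ v, Inf G Cs O v) : VirtuallyAlgebraicallyFibers (RACG G) := by
  have hS : Adm G (fam (G := G) Cs O) := fam_adm Cs O
    (fun s v h h' => by simpa using (hdisj _ _ _ _ _ h h').2) hno
  let K := (par G (fam (G := G) Cs O)).ker
  have hKf : K.FiniteIndex := by
    have := Subgroup.finiteIndex_ker (par G (fam (G := G) Cs O))
    exact this
  -- core steps
  have core_nmem : ∀ s b c, c ∈ Cs s b → ∀ j : Idx G O, j ≠ Sum.inl s → ∀ b', c ∉ fam Cs O j b' := by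
    rintro s b c hc (s' | ⟨⟨u, v⟩, huv, hu, hv, hn⟩) hj b' hc'
    · exact hj (by rw [(hdisj _ _ _ _ _ hc hc').1])
    · cases b' <;> simp only [fam, Set.mem_singleton_iff] at hc'
      · subst hc'; exact hO _ _ _ hc hv
      · subst hc'; exact hO _ _ _ hc hu
  have core_ht : ∀ s b c, c ∈ Cs s b → ∀ w, ht hS (w * xg G c) =
      ht hS w + sg b (hh hS (Sum.inl s) w) := by
    intro s b c hc w
    have h1 : ∀ j, hh hS j (w * xg G c) = hh hS j w +
        if j = Sum.inl s then sg b (hh hS (Sum.inl s) w) else 0 := by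
      intro j
      by_cases hj : j = Sum.inl s
      · subst hj; rw [if_pos rfl]; exact hh_mem hS w hc
      · rw [if_neg hj, add_zero]; exact hh_nmem hS w (core_nmem s b c hc j hj)
    simp only [ht, h1, Finset.sum_add_distrib, Finset.sum_ite_eq', Finset.mem_univ, if_true]
  let C : Set V := {c | ∃ s b, c ∈ Cs s b}
  have link : ∀ (ε : ℤ), (ε = 1 ∨ ε = -1) → ∀ w, ∀ c ∈ C, ∀ c' ∈ C,
      ht hS (w * xg G c) = ht hS w + ε → ht hS (w * xg G c') = ht hS w + ε →
      Conn C {y | ht hS y = ht hS w + ε ∨ ht hS y = ht hS w + 2 * ε} (w * xg G c) (w * xg G c') := by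
    intro ε hε w c hc c' hc' hcε hcε'
    let Sl : Set (RACG G) := {y | ht hS y = ht hS w + ε ∨ ht hS y = ht hS w + 2 * ε}
    have hb : ∀ s, ∃ b, sg b (hh hS (Sum.inl s) w) = ε ∧
        ∀ b', sg b' (hh hS (Sum.inl s) w) = ε → b' = b := by
      intro s
      have h1 := sg_cases true (hh hS (Sum.inl s) w)
      have h2 := sg_neg (hh hS (Sum.inl s) w)
      by_cases h : sg true (hh hS (Sum.inl s) w) = ε
      · refine ⟨true, h, ?_⟩
        rintro (_ | _) hb'
        · omega
        · rfl
      · refine ⟨false, by omega, ?_⟩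
        rintro (_ | _) hb'
        · rfl
        · omega
    choose xb hxb hxb' using hb
    have hmem : ∀ d ∈ C, ht hS (w * xg G d) = ht hS w + ε → ∃ s, d ∈ Cs s (xb s) := by
      rintro d ⟨s, b, hd⟩ h
      rw [core_ht s b d hd] at h
      refine ⟨s, ?_⟩
      rw [← hxb' s b (by omega)]; exact hd
    have hht : ∀ s, ∀ d ∈ Cs s (xb s), ht hS (w * xg G d) = ht hS w + ε := by
      intro s d hd
      rw [core_ht s _ d hd, hxb]
    have hsq : ∀ d ∈ Cs false (xb false), ∀ e ∈ Cs true (xb true), G.Adj d e →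
        Conn C Sl (w * xg G d) (w * xg G e) := by
      intro d hd e he hde
      have h1 := hht _ d hd
      have h2 := hht _ e he
      have h3 : ht hS (w * xg G d * xg G e) = ht hS w + 2 * ε := by
        rw [core_ht _ _ e he, h1, hh_nmem hS w (core_nmem _ _ d hd _ (by simp)), hxb]; ring
      have s1 : Conn C Sl (w * xg G d) (w * xg G d * xg G e) :=
        Conn.step ⟨_, _, he⟩ (Or.inl h1) (Or.inr h3)
      have s2 : Conn C Sl (w * xg G d * xg G e) (w * xg G d * xg G e * xg G d) := by
        refine Conn.step ⟨_, _, hd⟩ (Or.inr h3) ?_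
        rw [mul_assoc w, xg_comm hde, ← mul_assoc, xg_mul_cancel]
        exact Or.inl h2
      have e1 : w * xg G d * xg G e * xg G d = w * xg G e := by
        rw [mul_assoc w, xg_comm hde, ← mul_assoc, xg_mul_cancel]
      rw [e1] at s2
      exact s1.trans s2
    let X : Set V := {d | d ∈ Cs false (xb false) ∧ Conn C Sl (w * xg G c) (w * xg G d)}
    let Y : Set V := {d | d ∈ Cs true (xb true) ∧ Conn C Sl (w * xg G c) (w * xg G d)}
    have hXY := hbip (xb false) (xb true) X (fun d hd => hd.1) Y (fun d hd => hd.1) (by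
        obtain ⟨s, hs⟩ := hmem c hc hcε
        refine ⟨c, ?_⟩
        cases s
        · exact Or.inl ⟨hs, Relation.ReflTransGen.refl⟩
        · exact Or.inr ⟨hs, Relation.ReflTransGen.refl⟩)
      (by
        rintro x ⟨hx1, hx2⟩ d hd hxd
        exact ⟨hd, hx2.trans (hsq x hx1 d hd hxd)⟩)
      (by
        rintro x ⟨hx1, hx2⟩ d hd hxd
        exact ⟨hd, hx2.trans (hsq d hd x hx1 hxd.symm).symm⟩)
    obtain ⟨s, hs⟩ := hmem c' hc' hcε'
    cases s
    · rw [← hXY.1] at hs; exact hs.2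
    · rw [← hXY.2] at hs; exact hs.2
  have hgC : Good (ht hS) C := by
    intro R
    refine ⟨|R| + 1, ?_⟩
    intro t u g hg hu hug
    have h0 := le_abs_self R
    have h0' := abs_nonneg R
    have := slab_conn (C := C) (ht hS) (l := t - (|R| + 1)) (m := t + (|R| + 1)) (u := u) (g := g)
      (by rintro w c ⟨s, b, hc⟩
          rw [core_ht s b c hc]
          rcases sg_cases b (hh hS (Sum.inl s) w) with h | h <;> rw [h]
          · left; rfl
          · right; rfl)
      (by intro w c hc c' hc' h h'
          refine (link (-1) (Or.inr rfl) w c hc c' hc' h h').mono subset_rfl ?_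
          rintro y (hy | hy) <;> constructor <;> omega)
      (by intro w c hc c' hc' h h'
          refine (link 1 (Or.inl rfl) w c hc c' hc' h h').mono subset_rfl ?_
          rintro y (hy | hy) <;> constructor <;> omega)
      (by omega) hg (by rw [abs_le] at hu; constructor <;> omega)
      (by rw [abs_le] at hug; constructor <;> omega)
    refine this.mono (Set.subset_univ _) ?_
    rintro y ⟨hy1, hy2⟩
    have : |ht hS y - t| ≤ |R| + 1 := abs_le.2 ⟨by omega, by omega⟩
    exact this
  -- infecting pairs
  have reach1 : ∀ a ∈ Cs false true, ∀ b ∈ Cs false false, ∀ w t,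
      ∃ d ∈ sub G ({a, b} : Set V), |ht hS (w * d) - t| ≤ 4 := by
    intro a ha b hb w t
    exact ht_reach hS (i := Sum.inl false) true ha hb
      (fun j hj => Or.inl (core_nmem _ _ a ha j hj)) w t
  have reach2 : ∀ a ∈ O, ∀ b ∈ O, a < b → ¬ G.Adj a b → ∀ w t,
      ∃ d ∈ sub G ({a, b} : Set V), |ht hS (w * d) - t| ≤ 4 := by
    intro a ha b hb hab hn w t
    refine ht_reach hS (i := Sum.inr ⟨(a, b), hab, ha, hb, hn⟩) true rfl rfl ?_ w t
    rintro (s | ⟨⟨u, v⟩, huv, hu, hv, hnuv⟩) hj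
    · left; intro c hc; exact hO _ _ _ hc ha
    · by_contra hcon
      push Not at hcon
      obtain ⟨⟨c, hc⟩, ⟨c', hc'⟩⟩ := hcon
      apply hj
      have huv' : u < v := huv
      cases c <;> cases c' <;> simp only [fam, Set.mem_singleton_iff] at hc hc' <;> subst hc <;>
        subst hc'
      · exact absurd hab (lt_irrefl _)
      · exact absurd (hab.trans huv') (lt_irrefl _)
      · rfl
      · exact absurd hab (lt_irrefl _)
  -- maximal good set
  obtain ⟨A, ⟨hCA, hA⟩, hAmax⟩ := Set.Finite.exists_maximal
    (s := {A : Set V | C ⊆ A ∧ Good (ht hS) A}) (Set.toFinite _) ⟨C, subset_rfl, hgC⟩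
  have hins : ∀ v, Good (ht hS) (insert v A) → v ∈ A := by
    intro v hv
    exact hAmax ⟨hCA.trans (Set.subset_insert _ _), hv⟩ (Set.subset_insert v A) (Set.mem_insert v A)
  have hall : ∀ v, v ∈ A := by
    intro v
    induction hinf v with
    | core s b h => exact hCA ⟨s, b, h⟩
    | mid ha hb hva hvb =>
      exact hins _ (good_insert hA (hCA ⟨_, _, ha⟩) (hCA ⟨_, _, hb⟩) hva hvb
        (ht_bound hS _) (reach1 _ ha _ hb))
    | out ha hb hab hn _ _ hva hvb iha ihb =>
      rcases lt_or_gt_of_ne hab with h | h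
      · exact hins _ (good_insert hA iha ihb hva hvb (ht_bound hS _) (reach2 _ ha _ hb h hn))
      · exact hins _ (good_insert hA ihb iha hvb hva (ht_bound hS _)
          (reach2 _ hb _ ha h (fun h' => hn h'.symm)))
  have hAu : A = Set.univ := Set.eq_univ_of_forall hall
  rw [hAu] at hA
  refine fibers_of_good (ht hS) K (fun g hg w => ht_add hS hg w) hA ?_
  intro r
  obtain ⟨a, ha⟩ := hne true
  obtain ⟨b, hb⟩ := hne false
  obtain ⟨d, -, hd⟩ := reach1 a ha b hb 1 (r + 5)
  rw [abs_le] at hd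
  exact ⟨1 * d, by omega⟩

end thmD
end RFib

namespace RFib

section prune
variable {V : Type*} [Fintype V] [DecidableEq V] {G : SimpleGraph V}

/-- what remains -/
def rem (L : Bool → Bool → Finset V) (R : Bool → Bool → Bool → Finset V) (s b : Bool) : Finset V :=
  L s b \ (R s b true ∪ R s b false)

/-- valid removal -/
structure ValidR (G : SimpleGraph V) (L : Bool → Bool → Finset V) (k : ℕ)
    (R : Bool → Bool → Bool → Finset V) : Prop where
  sub : ∀ s b b', R s b b' ⊆ L s b
  small : ∀ s b b', (R s b b').card < k
  noedge : ∀ s b b', ∀ u ∈ R s b b', ∀ v ∈ rem L R (!s) b', ¬ G.Adj u v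

lemma rem_card {L : Bool → Bool → Finset V} {k m : ℕ} {R : Bool → Bool → Bool → Finset V}
    (hm : ∀ s b, (L s b).card = m) (hR : ValidR G L k R) (s b : Bool) :
    m + 2 ≤ (rem L R s b).card + 2 * k := by
  have h1 := Finset.le_card_sdiff (R s b true ∪ R s b false) (L s b)
  have h2 := Finset.card_union_le (R s b true) (R s b false)
  have h3 := hR.small s b true
  have h4 := hR.small s b false
  have h5 := hm s b
  unfold rem
  omega

lemma prune (L : Bool → Bool → Finset V) (k m : ℕ) (hk : 0 < k) (hm : ∀ s b, (L s b).card = m)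
    (hmk : 4 * k ≤ m)
    (hP : ∀ s b b', ∀ X ⊆ L s b, ∀ Y ⊆ L (!s) b', k ≤ X.card → k ≤ Y.card →
      ∃ x ∈ X, ∃ y ∈ Y, G.Adj x y) :
    ∃ L' : Bool → Bool → Finset V, (∀ s b, L' s b ⊆ L s b ∧ m ≤ (L' s b).card + 2 * k) ∧
      ∀ b b', BipConn G (L' false b : Set V) (L' true b' : Set V) := by
  obtain ⟨R, hR, hmax⟩ := Set.Finite.exists_maximal
    (s := {R : Bool → Bool → Bool → Finset V | ValidR G L k R}) (Set.toFinite _)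
    ⟨fun _ _ _ => ∅, ⟨by simp, by simpa using hk, by simp⟩⟩
  have hR : ValidR G L k R := hR
  have hrc := rem_card hm hR
  refine ⟨rem L R, fun s b => ⟨Finset.sdiff_subset, by have := hrc s b; omega⟩, ?_⟩
  -- no small closed pair
  have key : ∀ β β' : Bool, ∀ X ⊆ rem L R false β, ∀ Y ⊆ rem L R true β', X.card < k → Y.card < k →
      (∀ x ∈ X, ∀ d ∈ rem L R true β', G.Adj x d → d ∈ Y) →
      (∀ y ∈ Y, ∀ c ∈ rem L R false β, G.Adj y c → c ∈ X) → X = ∅ ∧ Y = ∅ := by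
    intro β β' X hX Y hY hXk hYk hXc hYc
    let R' : Bool → Bool → Bool → Finset V := fun s b b' => R s b b' ∪
      (if s then (if b = β' ∧ b' = β then Y else ∅) else (if b = β ∧ b' = β' then X else ∅))
    have hRR' : R ≤ R' := fun s b b' => Finset.subset_union_left
    have hremle : ∀ s b, rem L R' s b ⊆ rem L R s b := by
      intro s b
      exact Finset.sdiff_subset_sdiff subset_rfl
        (Finset.union_subset_union (hRR' _ _ _) (hRR' _ _ _))
    have hXR' : X ⊆ R' false β β' := by simp [R']
    have hYR' : Y ⊆ R' true β' β := by simp [R']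
    have hsubset : ∀ s b b' , R' s b b' ⊆ L s b := by
      intro s b b'
      refine Finset.union_subset (hR.sub s b b') ?_
      split_ifs with h1 h2 h2
      · obtain ⟨rfl, rfl⟩ := h2; subst h1; exact hY.trans Finset.sdiff_subset
      · simp
      · obtain ⟨rfl, rfl⟩ := h2
        have : s = false := by simpa using h1
        subst this; exact hX.trans Finset.sdiff_subset
      · simp
    have hrx : ∀ v ∈ rem L R' false β, v ∉ X := by
      intro v hv hvX
      have := hXR' hvX
      simp only [rem, Finset.mem_sdiff, Finset.mem_union] at hv
      cases β' <;> tauto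
    have hry : ∀ v ∈ rem L R' true β', v ∉ Y := by
      intro v hv hvX
      have := hYR' hvX
      simp only [rem, Finset.mem_sdiff, Finset.mem_union] at hv
      cases β <;> tauto
    have hnoedge : ∀ s b b', ∀ u ∈ R' s b b', ∀ v ∈ rem L R' (!s) b', ¬ G.Adj u v := by
      intro s b b' u hu v hv huv
      rcases Finset.mem_union.1 hu with hu | hu2
      · exact hR.noedge s b b' u hu v (hremle _ _ hv) huv
      · split_ifs at hu2 with h1 h2 h2
        · obtain ⟨rfl, rfl⟩ := h2; subst h1
          exact hrx v hv (hYc u hu2 v (hremle _ _ hv) huv)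
        · simp at hu2
        · obtain ⟨rfl, rfl⟩ := h2
          have : s = false := by simpa using h1
          subst this
          exact hry v hv (hXc u hu2 v (hremle _ _ hv) huv)
        · simp at hu2
    have hcx : ∀ s b, k ≤ (rem L R' s b).card := by
      intro s b
      have h1 : rem L R s b \ (if s then Y else X) ⊆ rem L R' s b := by
        intro v hv
        simp only [rem, Finset.mem_sdiff, Finset.mem_union, R'] at hv ⊢
        cases s
        · simp only [Bool.false_eq_true, if_false] at hv ⊢
          refine ⟨hv.1.1, ?_⟩
          rintro ((h | h) | (h | h))
          · exact hv.1.2 (Or.inl h)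
          · split_ifs at h
            · exact hv.2 h
            · simp at h
          · exact hv.1.2 (Or.inr h)
          · split_ifs at h
            · exact hv.2 h
            · simp at h
        · simp only [if_true] at hv ⊢
          refine ⟨hv.1.1, ?_⟩
          rintro ((h | h) | (h | h))
          · exact hv.1.2 (Or.inl h)
          · split_ifs at h
            · exact hv.2 h
            · simp at h
          · exact hv.1.2 (Or.inr h)
          · split_ifs at h
            · exact hv.2 h
            · simp at h
      have h2 := Finset.card_le_card h1
      have h3 := Finset.le_card_sdiff (if s then Y else X) (rem L R s b)
      have h4 := hrc s b
      have h5 : (if s then Y else X).card < k := by split_ifs <;> assumption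
      omega
    have hR' : ValidR G L k R' := by
      refine ⟨hsubset, ?_, hnoedge⟩
      intro s b b'
      by_contra hcon
      obtain ⟨x, hx, y, hy, hxy⟩ := hP s b b' (R' s b b') (hsubset s b b') (rem L R' (!s) b')
        Finset.sdiff_subset (by omega) (hcx _ _)
      exact hnoedge s b b' x hx y hy hxy
    have hle := hmax hR' hRR'
    constructor
    · rw [Finset.eq_empty_iff_forall_notMem]
      intro v hv
      have h1 := hle false β β' (hXR' hv)
      have h2 := hX hv
      simp only [rem, Finset.mem_sdiff, Finset.mem_union] at h2
      cases β' <;> tauto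
    · rw [Finset.eq_empty_iff_forall_notMem]
      intro v hv
      have h1 := hle true β' β (hYR' hv)
      have h2 := hY hv
      simp only [rem, Finset.mem_sdiff, Finset.mem_union] at h2
      cases β <;> tauto
  intro β β' X hX Y hY hne hXc hYc
  lift X to Finset V using Set.toFinite _
  lift Y to Finset V using Set.toFinite _
  simp only [Finset.mem_coe, Finset.coe_subset] at hX hY hXc hYc
  have c1 := hrc false β
  have c2 := hrc true β'
  have d1 := Finset.card_sdiff_add_card_eq_card hX
  have d2 := Finset.card_sdiff_add_card_eq_card hY
  have e1 : ¬ (k ≤ X.card ∧ k ≤ (rem L R true β' \ Y).card) := by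
    rintro ⟨h1, h2⟩
    obtain ⟨x, hx, y, hy, hxy⟩ := hP false β β' X (hX.trans Finset.sdiff_subset) _
      (Finset.sdiff_subset.trans Finset.sdiff_subset) h1 h2
    rw [Finset.mem_sdiff] at hy
    exact hy.2 (hXc x hx y hy.1 hxy)
  have e2 : ¬ (k ≤ Y.card ∧ k ≤ (rem L R false β \ X).card) := by
    rintro ⟨h1, h2⟩
    obtain ⟨x, hx, y, hy, hxy⟩ := hP true β' β Y (hY.trans Finset.sdiff_subset) _
      (Finset.sdiff_subset.trans Finset.sdiff_subset) h1 h2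
    rw [Finset.mem_sdiff] at hy
    exact hy.2 (hYc x hx y hy.1 hxy)
  by_cases hXk : X.card < k
  · have hYk : Y.card < k := by omega
    obtain ⟨rfl, rfl⟩ := key β β' X hX Y hY hXk hYk hXc hYc
    simp at hne
  · have := key β β' (rem L R false β \ X) Finset.sdiff_subset (rem L R true β' \ Y)
      Finset.sdiff_subset (by omega) (by omega)
      (by
        intro x hx d hd hxd
        rw [Finset.mem_sdiff] at hx ⊢
        exact ⟨hd, fun hdY => hx.2 (hYc d hdY x hx.1 hxd.symm)⟩)
      (by
        intro x hx d hd hxd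
        rw [Finset.mem_sdiff] at hx ⊢
        exact ⟨hd, fun hdY => hx.2 (hXc d hdY x hx.1 hxd.symm)⟩)
    rw [Finset.sdiff_eq_empty_iff_subset, Finset.sdiff_eq_empty_iff_subset] at this
    constructor
    · rw [Finset.Subset.antisymm hX this.1]
    · rw [Finset.Subset.antisymm hY this.2]

end prune
end RFib

namespace RFib

section prob
variable {I : Type*} [Fintype I] [DecidableEq I] {p : ℝ}

/-- weight of a configuration -/
noncomputable def wt (p : ℝ) (ω : I → Bool) : ℝ := ∏ i, (if ω i = true then p else 1 - p)

open Classical in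
/-- probability of an event -/
noncomputable def Pr (p : ℝ) (E : Set (I → Bool)) : ℝ := ∑ ω, if ω ∈ E then wt p ω else 0

lemma wt_nonneg (h : p ∈ Set.Icc (0 : ℝ) 1) (ω : I → Bool) : 0 ≤ wt p ω := by
  unfold wt
  refine Finset.prod_nonneg fun i _ => ?_
  split_ifs
  · exact h.1
  · linarith [h.2]

lemma Pr_nonneg (h : p ∈ Set.Icc (0 : ℝ) 1) (E : Set (I → Bool)) : 0 ≤ Pr p E := by
  unfold Pr
  refine Finset.sum_nonneg fun i _ => ?_
  split_ifs
  · exact wt_nonneg h _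
  · exact le_rfl

lemma Pr_mono (h : p ∈ Set.Icc (0 : ℝ) 1) {E F : Set (I → Bool)} (hEF : E ⊆ F) :
    Pr p E ≤ Pr p F := by
  unfold Pr
  refine Finset.sum_le_sum fun ω _ => ?_
  have := wt_nonneg h ω
  by_cases h1 : ω ∈ E
  · simp [h1, hEF h1]
  · simp only [h1, if_false]; split_ifs <;> simp [this]

lemma Pr_prod (g : I → Bool → Prop) [∀ i b, Decidable (g i b)] :
    Pr p {ω : I → Bool | ∀ i, g i (ω i)} =
      ∏ i, ((if g i true then p else 0) + (if g i false then 1 - p else 0)) := by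
  classical
  have h1 : ∀ i, ((if g i true then p else 0) + (if g i false then 1 - p else 0)) =
      ∑ b : Bool, if g i b then (if b = true then p else 1 - p) else 0 := by
    intro i; simp
  simp only [h1]
  rw [Finset.prod_univ_sum, Pr, Fintype.piFinset_univ]
  refine Finset.sum_congr rfl fun ω _ => ?_
  by_cases hω : ∀ i, g i (ω i)
  · have : ω ∈ {ω : I → Bool | ∀ i, g i (ω i)} := hω
    rw [if_pos this, wt]
    refine Finset.prod_congr rfl fun i _ => ?_
    rw [if_pos (hω i)]
  · have : ω ∉ {ω : I → Bool | ∀ i, g i (ω i)} := hω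
    rw [if_neg this]
    push Not at hω
    obtain ⟨i, hi⟩ := hω
    rw [Finset.prod_eq_zero (Finset.mem_univ i)]
    simp [hi]

lemma Pr_univ : Pr p (Set.univ : Set (I → Bool)) = 1 := by
  have := Pr_prod (I := I) (p := p) (fun _ _ => True)
  simpa using this

lemma sum_wt : ∑ ω : I → Bool, wt p ω = 1 := by
  have := Pr_univ (I := I) (p := p)
  simpa [Pr] using this

lemma Pr_le_one (h : p ∈ Set.Icc (0 : ℝ) 1) (E : Set (I → Bool)) : Pr p E ≤ 1 := by
  rw [← Pr_univ (I := I) (p := p)]; exact Pr_mono h (Set.subset_univ _)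

lemma Pr_empty : Pr p (∅ : Set (I → Bool)) = 0 := by simp [Pr]

lemma Pr_cyl (P Q : Finset I) (hPQ : Disjoint P Q) :
    Pr p {ω : I → Bool | (∀ i ∈ P, ω i = true) ∧ ∀ i ∈ Q, ω i = false} =
      p ^ P.card * (1 - p) ^ Q.card := by
  have h := Pr_prod (I := I) (p := p) (fun i b => (i ∈ P → b = true) ∧ (i ∈ Q → b = false))
  have e : {ω : I → Bool | ∀ i, (i ∈ P → ω i = true) ∧ (i ∈ Q → ω i = false)} =
      {ω : I → Bool | (∀ i ∈ P, ω i = true) ∧ ∀ i ∈ Q, ω i = false} := by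
    ext ω; exact forall_and
  rw [e] at h
  rw [h]
  have h2 : ∀ i, ((if (i ∈ P → true = true) ∧ (i ∈ Q → true = false) then p else 0) +
      (if (i ∈ P → false = true) ∧ (i ∈ Q → false = false) then 1 - p else 0)) =
      (if i ∈ P then p else 1) * (if i ∈ Q then 1 - p else 1) := by
    intro i
    by_cases hP : i ∈ P
    · have hQ : i ∉ Q := Finset.disjoint_left.1 hPQ hP
      simp [hP, hQ]
    · by_cases hQ : i ∈ Q <;> simp [hP, hQ]
  rw [Finset.prod_congr rfl (fun i _ => h2 i), Finset.prod_mul_distrib]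
  simp [Finset.prod_ite_mem]

lemma Pr_false (Q : Finset I) :
    Pr p {ω : I → Bool | ∀ i ∈ Q, ω i = false} = (1 - p) ^ Q.card := by
  have := Pr_cyl (p := p) (∅ : Finset I) Q (by simp)
  simpa using this

lemma Pr_true (Q : Finset I) :
    Pr p {ω : I → Bool | ∀ i ∈ Q, ω i = true} = p ^ Q.card := by
  have := Pr_cyl (p := p) Q (∅ : Finset I) (by simp)
  simpa using this

lemma Pr_union (h : p ∈ Set.Icc (0 : ℝ) 1) (E F : Set (I → Bool)) :
    Pr p (E ∪ F) ≤ Pr p E + Pr p F := by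
  unfold Pr
  rw [← Finset.sum_add_distrib]
  refine Finset.sum_le_sum fun ω _ => ?_
  have := wt_nonneg h ω
  by_cases h1 : ω ∈ E <;> by_cases h2 : ω ∈ F <;> simp [h1, h2, this]

lemma Pr_compl (E : Set (I → Bool)) : Pr p Eᶜ = 1 - Pr p E := by
  rw [eq_sub_iff_add_eq, ← sum_wt (I := I) (p := p), Pr, Pr, ← Finset.sum_add_distrib]
  refine Finset.sum_congr rfl fun ω _ => ?_
  by_cases h1 : ω ∈ E <;> simp [h1]

lemma Pr_biUnion (h : p ∈ Set.Icc (0 : ℝ) 1) {α : Type*} (s : Finset α)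
    (E : α → Set (I → Bool)) (F : Set (I → Bool)) (hF : ∀ ω ∈ F, ∃ a ∈ s, ω ∈ E a) :
    Pr p F ≤ ∑ a ∈ s, Pr p (E a) := by
  classical
  unfold Pr
  rw [Finset.sum_comm]
  refine Finset.sum_le_sum fun ω _ => ?_
  have h0 := wt_nonneg h ω
  have hn : ∀ a ∈ s, 0 ≤ (if ω ∈ E a then wt p ω else 0) := by
    intro a _; split_ifs <;> simp [h0]
  by_cases h1 : ω ∈ F
  · obtain ⟨a, ha, hω⟩ := hF ω h1
    rw [if_pos h1]
    refine le_trans ?_ (Finset.single_le_sum hn ha)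
    rw [if_pos hω]
  · rw [if_neg h1]; exact Finset.sum_nonneg hn

lemma Pr_biUnion_le (h : p ∈ Set.Icc (0 : ℝ) 1) {α : Type*} (s : Finset α)
    (E : α → Set (I → Bool)) (F : Set (I → Bool)) (hF : ∀ ω ∈ F, ∃ a ∈ s, ω ∈ E a) (c : ℝ)
    (hc : ∀ a ∈ s, Pr p (E a) ≤ c) : Pr p F ≤ s.card * c := by
  refine (Pr_biUnion h s E F hF).trans ?_
  rw [← nsmul_eq_mul]
  exact Finset.sum_le_card_nsmul _ _ _ hc

/-- merge two configurations -/
def mrg (S : Finset I) (ω ω' : I → Bool) : I → Bool := fun i => if i ∈ S then ω i else ω' i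

lemma mrg_in {S : Finset I} {ω ω' : I → Bool} {i : I} (h : i ∈ S) : mrg S ω ω' i = ω i := by
  simp [mrg, h]

lemma mrg_out {S : Finset I} {ω ω' : I → Bool} {i : I} (h : i ∉ S) : mrg S ω ω' i = ω' i := by
  simp [mrg, h]

lemma wt_mrg (S : Finset I) (ω ω' : I → Bool) :
    wt p (mrg S ω ω') * wt p (mrg S ω' ω) = wt p ω * wt p ω' := by
  unfold wt
  rw [← Finset.prod_mul_distrib, ← Finset.prod_mul_distrib]
  refine Finset.prod_congr rfl fun i _ => ?_
  by_cases hi : i ∈ S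
  · rw [mrg_in hi, mrg_in hi]
  · rw [mrg_out hi, mrg_out hi, mul_comm]

lemma Pr_mrg (S : Finset I) (E : Set (I → Bool)) :
    Pr p E = ∑ ω : I → Bool, wt p ω * Pr p {ω' | mrg S ω ω' ∈ E} := by
  classical
  let e : (I → Bool) × (I → Bool) ≃ (I → Bool) × (I → Bool) :=
    Function.Involutive.toPerm (fun q => (mrg S q.1 q.2, mrg S q.2 q.1)) (by
      rintro ⟨a, b⟩
      refine Prod.ext ?_ ?_ <;> funext i <;> by_cases hi : i ∈ S <;> simp [mrg, hi])
  have h1 : ∑ ω : I → Bool, wt p ω * Pr p {ω' | mrg S ω ω' ∈ E} =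
      ∑ q : (I → Bool) × (I → Bool), wt p q.1 * wt p q.2 * (if mrg S q.1 q.2 ∈ E then 1 else 0) := by
    rw [Fintype.sum_prod_type]
    refine Finset.sum_congr rfl fun ω _ => ?_
    rw [Pr, Finset.mul_sum]
    refine Finset.sum_congr rfl fun ω' _ => ?_
    simp [mul_assoc]
  have h2 : ∑ q : (I → Bool) × (I → Bool), wt p q.1 * wt p q.2 *
      (if mrg S q.1 q.2 ∈ E then 1 else 0) =
      ∑ q : (I → Bool) × (I → Bool), wt p q.1 * wt p q.2 * (if q.1 ∈ E then 1 else 0) := by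
    rw [← e.sum_comp (fun q => wt p q.1 * wt p q.2 * (if q.1 ∈ E then (1 : ℝ) else 0))]
    refine Finset.sum_congr rfl fun q _ => ?_
    change _ = wt p (mrg S q.1 q.2) * wt p (mrg S q.2 q.1) * _
    rw [wt_mrg]; rfl
  rw [h1, h2, Fintype.sum_prod_type, Pr]
  refine Finset.sum_congr rfl fun ω _ => ?_
  have : ∑ ω' : I → Bool, wt p ω * wt p ω' * (if ω ∈ E then (1:ℝ) else 0) =
    wt p ω * (if ω ∈ E then 1 else 0) * ∑ ω' : I → Bool, wt p ω' := by
    rw [Finset.mul_sum]; refine Finset.sum_congr rfl fun ω' _ => ?_; ring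
  rw [this, sum_wt]; simp

/-- conditioning bound -/
lemma Pr_cond (h : p ∈ Set.Icc (0 : ℝ) 1) (S : Finset I) (B E : Set (I → Bool)) (ε : ℝ)
    (hin : ∀ ω, ω ∈ E → Pr p {ω' | mrg S ω ω' ∈ B} ≤ ε)
    (hout : ∀ ω ω', mrg S ω ω' ∈ B → ω ∈ E) : Pr p B ≤ ε * Pr p E := by
  classical
  rw [Pr_mrg S B, Pr, Finset.mul_sum]
  refine Finset.sum_le_sum fun ω _ => ?_
  by_cases hω : ω ∈ E
  · rw [if_pos hω, mul_comm]
    exact mul_le_mul_of_nonneg_right (hin ω hω) (wt_nonneg h ω)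
  · have : {ω' | mrg S ω ω' ∈ B} = ∅ := by
      ext ω'; simp only [Set.mem_ofPred_eq, Set.mem_empty_iff_false, iff_false]
      exact fun h' => hω (hout ω ω' h')
    rw [this, Pr_empty, if_neg hω]; simp

lemma Pr_cond' (h : p ∈ Set.Icc (0 : ℝ) 1) (S : Finset I) (B : Set (I → Bool)) (ε : ℝ)
    (hin : ∀ ω, Pr p {ω' | mrg S ω ω' ∈ B} ≤ ε) : Pr p B ≤ ε := by
  have := Pr_cond h S B Set.univ ε (fun ω _ => hin ω) (fun _ _ _ => trivial)
  rwa [Pr_univ, mul_one] at this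

/-- event depending on coordinates in `S` only -/
def Dep (S : Finset I) (E : Set (I → Bool)) : Prop :=
  ∀ ω ω', (∀ i ∈ S, ω i = ω' i) → ω ∈ E → ω' ∈ E

lemma Pr_inter_le (h : p ∈ Set.Icc (0 : ℝ) 1) (S T : Finset I) (hST : Disjoint S T)
    (E F : Set (I → Bool)) (hE : Dep S E) (hF : Dep T F) :
    Pr p (E ∩ F) ≤ Pr p F * Pr p E := by
  refine Pr_cond h S _ _ _ ?_ ?_
  · intro ω _
    refine Pr_mono h ?_
    intro ω' hω'
    refine hF _ _ (fun i hi => ?_) hω'.2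
    exact mrg_out (fun hS => Finset.disjoint_left.1 hST hS hi)
  · intro ω ω' hω
    exact hE _ _ (fun i hi => mrg_in hi) hω.1

lemma Pr_biInter_le (h : p ∈ Set.Icc (0 : ℝ) 1) {α : Type*} [DecidableEq α] (Z : Finset α)
    (S : α → Finset I) (E : α → Set (I → Bool)) (hd : ∀ a ∈ Z, ∀ b ∈ Z, a ≠ b →
      Disjoint (S a) (S b)) (hE : ∀ a ∈ Z, Dep (S a) (E a)) (c : ℝ)
      (hc : ∀ a ∈ Z, Pr p (E a) ≤ c) :
    Pr p {ω | ∀ a ∈ Z, ω ∈ E a} ≤ c ^ Z.card := by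
  induction Z using Finset.induction_on with
  | empty => simpa using Pr_le_one h _
  | insert a Z ha ih =>
    have ih' := ih (fun x hx y hy => hd x (Finset.mem_insert_of_mem hx) y
      (Finset.mem_insert_of_mem hy)) (fun x hx => hE x (Finset.mem_insert_of_mem hx))
      (fun x hx => hc x (Finset.mem_insert_of_mem hx))
    have hc0 : 0 ≤ c := (Pr_nonneg h _).trans (hc a (Finset.mem_insert_self _ _))
    have e : {ω : I → Bool | ∀ x ∈ insert a Z, ω ∈ E x} ⊆ E a ∩ {ω | ∀ x ∈ Z, ω ∈ E x} := by
      intro ω hω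
      exact ⟨hω a (Finset.mem_insert_self _ _), fun x hx => hω x (Finset.mem_insert_of_mem hx)⟩
    refine (Pr_mono h e).trans ?_
    refine (Pr_inter_le h (S a) (Z.biUnion S) ?_ _ _ (hE a (Finset.mem_insert_self _ _)) ?_).trans ?_
    · rw [Finset.disjoint_biUnion_right]
      intro x hx
      exact hd a (Finset.mem_insert_self _ _) x (Finset.mem_insert_of_mem hx)
        (fun h' => ha (h' ▸ hx))
    · intro ω ω' hωω' hω x hx
      refine hE x (Finset.mem_insert_of_mem hx) ω ω' (fun i hi => hωω' i ?_) (hω x hx)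
      exact Finset.mem_biUnion.2 ⟨x, hx, hi⟩
    · rw [Finset.card_insert_of_notMem ha, pow_succ]
      exact mul_le_mul ih' (hc a (Finset.mem_insert_self _ _)) (Pr_nonneg h _) (pow_nonneg hc0 _)

/-- binomial tail -/
lemma Pr_tail (h : p ∈ Set.Icc (0 : ℝ) 1) {α : Type*} [DecidableEq α] (Y : Finset α)
    (S : α → Finset I) (E : α → Set (I → Bool)) (hd : ∀ a ∈ Y, ∀ b ∈ Y, a ≠ b →
      Disjoint (S a) (S b)) (hE : ∀ a ∈ Y, Dep (S a) (E a)) (c : ℝ)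
      (hc : ∀ a ∈ Y, Pr p (E a) ≤ c) (j : ℕ) :
    Pr p {ω | ∃ Q ⊆ Y, Q.card = j ∧ ∀ a ∈ Q, ω ∈ E a} ≤ (Y.card.choose j) * c ^ j := by
  rw [← Finset.card_powersetCard]
  refine Pr_biUnion_le h (Y.powersetCard j) (fun Q => {ω | ∀ a ∈ Q, ω ∈ E a}) _ ?_ _ ?_
  · rintro ω ⟨Q, hQ, hj, hω⟩
    exact ⟨Q, Finset.mem_powersetCard.2 ⟨hQ, hj⟩, hω⟩
  · intro Q hQ
    obtain ⟨hQ, hj⟩ := Finset.mem_powersetCard.1 hQ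
    rw [← hj]
    exact Pr_biInter_le h Q S E (fun a ha b hb => hd a (hQ ha) b (hQ hb))
      (fun a ha => hE a (hQ ha)) c (fun a ha => hc a (hQ ha))

lemma bern_singleton (b : Bool) :
    bernoulliMeasure p {b} = ENNReal.ofReal (if b = true then p else 1 - p) := by
  cases b <;> simp [bernoulliMeasure]

lemma bern_prob (h : p ∈ Set.Icc (0 : ℝ) 1) : IsProbabilityMeasure (bernoulliMeasure p) := by
  constructor
  simp only [bernoulliMeasure, Measure.coe_add, Measure.coe_smul, Pi.add_apply, Pi.smul_apply,
    measure_univ, smul_eq_mul, mul_one]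
  rw [← ENNReal.ofReal_add h.1 (by linarith [h.2])]
  simp

lemma pi_eq_Pr (h : p ∈ Set.Icc (0 : ℝ) 1) (E : Set (I → Bool)) :
    (Measure.pi fun _ : I => bernoulliMeasure p) E = ENNReal.ofReal (Pr p E) := by
  classical
  have := bern_prob h
  have hE : MeasurableSet E := Set.Finite.measurableSet (Set.toFinite E)
  rw [← lintegral_indicator_one hE, lintegral_fintype, Pr, ENNReal.ofReal_sum_of_nonneg]
  · refine Finset.sum_congr rfl fun ω _ => ?_
    rw [Measure.pi_singleton]
    simp only [bern_singleton]
    by_cases hω : ω ∈ E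
    · rw [if_pos hω, Set.indicator_of_mem hω, Pi.one_apply, one_mul, wt,
        ENNReal.ofReal_prod_of_nonneg]
      intro i _
      split_ifs
      · exact h.1
      · linarith [h.2]
    · simp [hω]
  · intro ω _
    split_ifs
    · exact wt_nonneg h ω
    · exact le_rfl

end prob

section edges
variable {n : ℕ}

/-- edges between two vertex sets -/
def btw (X Y : Finset (Fin n)) : Finset (Sym2 (Fin n)) := (X ×ˢ Y).image (fun q => s(q.1, q.2))

lemma mem_btw {X Y : Finset (Fin n)} {x y : Fin n} (hx : x ∈ X) (hy : y ∈ Y) :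
    s(x, y) ∈ btw X Y := Finset.mem_image.2 ⟨(x, y), Finset.mem_product.2 ⟨hx, hy⟩, rfl⟩

lemma card_btw {X Y : Finset (Fin n)} (h : Disjoint X Y) : (btw X Y).card = X.card * Y.card := by
  rw [btw, Finset.card_image_of_injOn, Finset.card_product]
  rintro ⟨a, b⟩ hab ⟨c, d⟩ hcd he
  simp only [Finset.coe_product, Set.mem_prod, Finset.mem_coe] at hab hcd
  simp only [Sym2.eq_iff] at he
  rcases he with ⟨rfl, rfl⟩ | ⟨rfl, rfl⟩
  · rfl
  · exact absurd hcd.2 (Finset.disjoint_left.1 h hab.1)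

lemma adj_iff {ω : Sym2 (Fin n) → Bool} {u v : Fin n} (h : u ≠ v) :
    (graphOf ω).Adj u v ↔ ω s(u, v) = true := by
  simp [graphOf, h]

lemma Pr_noedge {p : ℝ} {X Y : Finset (Fin n)} (h : Disjoint X Y) :
    Pr p {ω : Sym2 (Fin n) → Bool | ∀ i ∈ btw X Y, ω i = false} = (1 - p) ^ (X.card * Y.card) := by
  rw [Pr_false, card_btw h]

end edges
end RFib

namespace RFib

section dense
variable {n : ℕ} {p : ℝ}

lemma two_subsets {α : Type*} [DecidableEq α] (R : Finset α) (i j : ℕ) (h : i + j ≤ R.card) :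
    ∃ X ⊆ R, ∃ Y ⊆ R, Disjoint X Y ∧ X.card = i ∧ Y.card = j := by
  obtain ⟨X, hX, hXc⟩ := Finset.exists_subset_card_eq (s := R) (n := i) (by omega)
  have h1 := Finset.card_sdiff_add_card_eq_card hX
  obtain ⟨Y, hY, hYc⟩ := Finset.exists_subset_card_eq (s := R \ X) (n := j) (by omega)
  exact ⟨X, hX, Y, hY.trans Finset.sdiff_subset,
    (Finset.disjoint_of_subset_left hY Finset.sdiff_disjoint).symm, hXc, hYc⟩

lemma btw_disj {X : Finset (Fin n)} {u u' : Fin n} (h : u ≠ u') (hu : u ∉ X) :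
    Disjoint (btw {u} X) (btw {u'} X) := by
  rw [Finset.disjoint_left]
  intro i hi hi'
  simp only [btw, Finset.mem_image, Finset.mem_product, Finset.mem_singleton, Prod.exists] at hi hi'
  obtain ⟨a, b, ⟨rfl, hb⟩, rfl⟩ := hi
  obtain ⟨c, d, ⟨rfl, hd⟩, he⟩ := hi'
  rw [Sym2.eq_iff] at he
  rcases he with ⟨h1, h2⟩ | ⟨h1, h2⟩
  · exact h h1.symm
  · exact hu (h2 ▸ hd)

lemma notMem_btw {X Y : Finset (Fin n)} {x y : Fin n} (hx : x ∉ Y) (hy : y ∉ Y) :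
    s(x, y) ∉ btw X Y := by
  intro h
  simp only [btw, Finset.mem_image, Finset.mem_product, Prod.exists] at h
  obtain ⟨a, b, ⟨ha, hb⟩, he⟩ := h
  rw [Sym2.eq_iff] at he
  rcases he with ⟨rfl, rfl⟩ | ⟨rfl, rfl⟩
  · exact hy hb
  · exact hx hb

/-- common neighbours -/
def cn (a b v : Fin n) (ω : Sym2 (Fin n) → Bool) : Finset (Fin n) :=
  (Finset.univ \ {a, b, v}).filter (fun u => ∀ x ∈ ({a, b, v} : Finset (Fin n)), ω s(u, x) = true)

lemma Pr_cn_small (hp : p ∈ Set.Icc (0 : ℝ) 1) {c : ℝ} (hc0 : 0 ≤ c) (hc : c ≤ p) {a b v : Fin n}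
    (hab : a ≠ b) (hav : a ≠ v) (hbv : b ≠ v) (h : ℕ) (hn : 2 * h + 3 ≤ n) :
    Pr p {ω | (cn a b v ω).card < 2 * h} ≤ (n : ℝ) ^ (2 * h) * (1 - c ^ 3) ^ (n - 3 - 2 * h) := by
  have h3 : ({a, b, v} : Finset (Fin n)).card = 3 := Finset.card_eq_three.2 ⟨a, b, v, hab, hav, hbv, rfl⟩
  set X : Finset (Fin n) := {a, b, v} with hX
  have hW : (Finset.univ \ X).card = n - 3 := by
    rw [Finset.card_sdiff_of_subset (Finset.subset_univ _), h3, Finset.card_univ, Fintype.card_fin]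
  have h1 := Pr_tail hp (Finset.univ \ X) (fun u => btw {u} X)
    (fun u => {ω | ∀ i ∈ btw {u} X, ω i = true}ᶜ)
    (fun u hu u' _ huu' => btw_disj huu' (Finset.mem_sdiff.1 hu).2)
    (fun u _ ω ω' hω hu hu' => hu (fun i hi => by rw [hω i hi]; exact hu' i hi))
    (1 - c ^ 3)
    (by
      intro u hu
      rw [Pr_compl, Pr_true, card_btw, h3, Finset.card_singleton]
      · have := pow_le_pow_left₀ hc0 hc 3
        rw [one_mul]; linarith
      · simpa using (Finset.mem_sdiff.1 hu).2) (n - 3 - 2 * h)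
  refine (Pr_mono hp ?_).trans (h1.trans ?_)
  · intro ω hω
    have hω : (cn a b v ω).card < 2 * h := hω
    have hsub : cn a b v ω ⊆ Finset.univ \ X := Finset.filter_subset _ _
    have := Finset.card_sdiff_add_card_eq_card hsub
    obtain ⟨Q, hQ, hQc⟩ := Finset.exists_subset_card_eq (s := (Finset.univ \ X) \ cn a b v ω)
      (n := n - 3 - 2 * h) (by omega)
    refine ⟨Q, hQ.trans Finset.sdiff_subset, hQc, ?_⟩
    intro u hu hall
    have hu' := Finset.mem_sdiff.1 (hQ hu)
    apply hu'.2
    refine Finset.mem_filter.2 ⟨hu'.1, fun x hx => hall _ (mem_btw (Finset.mem_singleton_self _) hx)⟩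
  · have hcp : c ^ 3 ≤ 1 := pow_le_one₀ hc0 (hc.trans hp.2)
    refine mul_le_mul_of_nonneg_right ?_ (pow_nonneg (by linarith) _)
    rw [hW, Nat.choose_symm (by omega)]
    exact_mod_cast (Nat.choose_le_pow _ _).trans (Nat.pow_le_pow_left (by omega) _)

/-- bad triple event -/
def badT (a b v : Fin n) : Set (Sym2 (Fin n) → Bool) :=
  {ω | ω s(a, b) = false ∧ (ω s(v, a) = false ∨ ω s(v, b) = false) ∧
    ∀ x ∈ cn a b v ω, ∀ y ∈ cn a b v ω, x ≠ y → ω s(x, y) = true}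

lemma Pr_badT (hp : p ∈ Set.Icc (0 : ℝ) 1) {c : ℝ} (hc0 : 0 ≤ c) (hc : c ≤ p) {a b v : Fin n}
    (hab : a ≠ b) (hav : a ≠ v) (hbv : b ≠ v) (h : ℕ) (hn : 2 * h + 3 ≤ n) :
    Pr p (badT a b v) ≤ 2 * (1 - p) ^ 2 * p ^ (h * h) +
      (n : ℝ) ^ (2 * h) * (1 - c ^ 3) ^ (n - 3 - 2 * h) := by
  set X : Finset (Fin n) := {a, b, v} with hX
  have haX : a ∈ X := by simp [hX]
  have hbX : b ∈ X := by simp [hX]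
  have hvX : v ∈ X := by simp [hX]
  let E : Set (Sym2 (Fin n) → Bool) := {ω | ω s(a, b) = false ∧ (ω s(v, a) = false ∨ ω s(v, b) = false)}
  have hE : Pr p E ≤ 2 * (1 - p) ^ 2 := by
    have e : E ⊆ {ω | ∀ i ∈ ({s(a, b), s(v, a)} : Finset (Sym2 (Fin n))), ω i = false} ∪
        {ω | ∀ i ∈ ({s(a, b), s(v, b)} : Finset (Sym2 (Fin n))), ω i = false} := by
      rintro ω ⟨h1, h2 | h2⟩
      · left; intro i hi; simp only [Finset.mem_insert, Finset.mem_singleton] at hi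
        rcases hi with rfl | rfl <;> assumption
      · right; intro i hi; simp only [Finset.mem_insert, Finset.mem_singleton] at hi
        rcases hi with rfl | rfl <;> assumption
    refine (Pr_mono hp e).trans ((Pr_union hp _ _).trans ?_)
    rw [Pr_false, Pr_false, Finset.card_pair, Finset.card_pair]
    · linarith
    · simp only [ne_eq, Sym2.eq_iff]; tauto
    · simp only [ne_eq, Sym2.eq_iff]; tauto
  have hsplit : badT a b v ⊆ (badT a b v ∩ {ω | 2 * h ≤ (cn a b v ω).card}) ∪
      {ω | (cn a b v ω).card < 2 * h} := by
    intro ω hω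
    rcases lt_or_ge (cn a b v ω).card (2 * h) with h1 | h1
    · exact Or.inr h1
    · exact Or.inl ⟨hω, h1⟩
  refine (Pr_mono hp hsplit).trans ((Pr_union hp _ _).trans (add_le_add ?_
    (Pr_cn_small hp hc0 hc hab hav hbv h hn)))
  have hS : ∀ ω ω' : Sym2 (Fin n) → Bool, ∀ u, ∀ x ∈ X, mrg (btw Finset.univ X) ω ω' s(u, x) = ω s(u, x) :=
    fun ω ω' u x hx => mrg_in (mem_btw (Finset.mem_univ _) hx)
  have hcn : ∀ ω ω' : Sym2 (Fin n) → Bool, cn a b v (mrg (btw Finset.univ X) ω ω') = cn a b v ω := by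
    intro ω ω'
    unfold cn
    refine Finset.filter_congr fun u _ => ?_
    refine forall₂_congr fun x hx => ?_
    rw [hS ω ω' u x hx]
  have := Pr_cond hp (btw Finset.univ X) (badT a b v ∩ {ω | 2 * h ≤ (cn a b v ω).card}) E (p ^ (h * h)) ?_ ?_
  · refine this.trans ?_
    rw [mul_comm (2 * (1 - p) ^ 2)]
    exact mul_le_mul_of_nonneg_left hE (pow_nonneg hp.1 _)
  · intro ω _
    by_cases hcard : 2 * h ≤ (cn a b v ω).card
    · obtain ⟨Y, hY, Z, hZ, hYZ, hYc, hZc⟩ := two_subsets (cn a b v ω) h h (by omega)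
      have hPr := Pr_true (p := p) (btw Y Z)
      rw [card_btw hYZ, hYc, hZc] at hPr
      rw [← hPr]
      refine Pr_mono hp ?_
      rintro ω' ⟨⟨-, -, h3⟩, -⟩ i hi
      rw [hcn] at h3
      simp only [btw, Finset.mem_image, Finset.mem_product, Prod.exists] at hi
      obtain ⟨y, z, ⟨hy, hz⟩, rfl⟩ := hi
      have := h3 y (hY hy) z (hZ hz) (fun e => Finset.disjoint_left.1 hYZ hy (e ▸ hz))
      rwa [mrg_out] at this
      refine notMem_btw ?_ ?_
      · exact (Finset.mem_sdiff.1 (Finset.mem_filter.1 (hY hy)).1).2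
      · exact (Finset.mem_sdiff.1 (Finset.mem_filter.1 (hZ hz)).1).2
    · refine le_trans (le_of_eq ?_) (pow_nonneg hp.1 _)
      convert Pr_empty (p := p) (I := Sym2 (Fin n))
      ext ω'
      simp only [Set.mem_ofPred_eq, Set.mem_empty_iff_false, iff_false]
      rintro ⟨-, h2⟩
      rw [Set.mem_ofPred_eq, hcn] at h2
      exact hcard h2
  · rintro ω ω' ⟨⟨h1, h2, -⟩, -⟩
    rw [hS ω ω' _ _ hbX] at h1
    rw [hS ω ω' _ _ haX, hS ω ω' _ _ hbX] at h2
    exact ⟨h1, h2⟩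

lemma dense_det (ω : Sym2 (Fin n) → Bool) {a b : Fin n} (hab : a ≠ b) (hω : ω s(a, b) = false)
    (hT : ∀ v, a ≠ v → b ≠ v → ω ∉ badT a b v) :
    VirtuallyAlgebraicallyFibers (RACG (graphOf ω)) := by
  have hnadj : ¬ (graphOf ω).Adj a b := by rw [adj_iff hab, hω]; simp
  let Cs : Bool → Bool → Set (Fin n) := fun s b' => if s then ∅ else if b' then {a} else {b}
  have hmid : ∀ v, (graphOf ω).Adj v a → (graphOf ω).Adj v b →
      Inf (graphOf ω) Cs {x | x ≠ a ∧ x ≠ b} v := fun v h1 h2 =>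
    Inf.mid (a := a) (b := b) (by simp [Cs]) (by simp [Cs]) h1 h2
  refine thmD Cs {x | x ≠ a ∧ x ≠ b} ?_ ?_ ?_ ?_ ?_ ?_
  · rintro (_ | _) (_ | _) (_ | _) (_ | _) v h1 h2 <;>
      simp only [Cs, if_true, Bool.false_eq_true, if_false, Set.mem_singleton_iff,
        Set.mem_empty_iff_false] at h1 h2 <;> first
        | exact ⟨rfl, rfl⟩
        | exact absurd (h1.symm.trans h2) hab
        | exact absurd (h2.symm.trans h1) hab
  · rintro (_ | _) (_ | _) v h1 ⟨h2, h3⟩ <;>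
      simp only [Cs, if_true, Bool.false_eq_true, if_false, Set.mem_singleton_iff,
        Set.mem_empty_iff_false] at h1 <;> first
        | exact h3 h1
        | exact h2 h1
  · rintro (_ | _) u v h1 h2 <;>
      simp only [Cs, if_true, Bool.false_eq_true, if_false, Set.mem_singleton_iff,
        Set.mem_empty_iff_false] at h1 h2
    subst h1; subst h2; exact hnadj
  · rintro (_ | _) <;> simp [Cs]
  · intro c c' X hX Y hY hne _ _
    have hYe : Y = ∅ := by
      have : Y ⊆ ∅ := by simpa [Cs] using hY
      exact Set.subset_empty_iff.1 this
    subst hYe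
    rw [Set.union_empty] at hne
    refine ⟨?_, by simp [Cs]⟩
    have : ∃ x, Cs false c = {x} := by cases c <;> simp [Cs]
    obtain ⟨x, hx⟩ := this
    rw [hx] at hX ⊢
    exact (Set.Nonempty.subset_singleton_iff hne).1 hX
  · intro v
    by_cases hva : v = a
    · exact Inf.core false true (by simp [Cs, hva])
    by_cases hvb : v = b
    · exact Inf.core false false (by simp [Cs, hvb])
    by_cases h2 : ω s(v, a) = true ∧ ω s(v, b) = true
    · exact hmid v ((adj_iff hva).2 h2.1) ((adj_iff hvb).2 h2.2)
    have h3 := hT v (Ne.symm hva) (Ne.symm hvb)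
    have h4 : ∃ x ∈ cn a b v ω, ∃ y ∈ cn a b v ω, x ≠ y ∧ ω s(x, y) = false := by
      by_contra hcon
      push Not at hcon
      apply h3
      refine ⟨hω, ?_, fun x hx y hy hxy => by simpa using hcon x hx y hy hxy⟩
      by_contra hcon2
      push Not at hcon2
      exact h2 (by simpa using hcon2)
    obtain ⟨x, hx, y, hy, hxy, hxyω⟩ := h4
    have hprop : ∀ x ∈ cn a b v ω, (x ≠ a ∧ x ≠ b) ∧ (graphOf ω).Adj x a ∧ (graphOf ω).Adj x b ∧
        (graphOf ω).Adj v x := by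
      intro x hx
      have h5 := Finset.mem_filter.1 hx
      simp only [Finset.mem_sdiff, Finset.mem_univ, true_and, Finset.mem_insert,
        Finset.mem_singleton, not_or, forall_eq_or_imp, forall_eq] at h5
      obtain ⟨⟨e1, e2, e3⟩, f1, f2, f3⟩ := h5
      exact ⟨⟨e1, e2⟩, (adj_iff e1).2 f1, (adj_iff e2).2 f2, ((adj_iff e3).2 f3).symm⟩
    obtain ⟨px, xa, xb, vx⟩ := hprop x hx
    obtain ⟨py, ya, yb, vy⟩ := hprop y hy
    exact Inf.out px py hxy (by rw [adj_iff hxy, hxyω]; simp) (hmid x xa xb) (hmid y ya yb) vx vy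

/-- the bad event -/
def Bad (n : ℕ) : Set (Sym2 (Fin n) → Bool) := {ω | ¬ VirtuallyAlgebraicallyFibers (RACG (graphOf ω))}

lemma dense_bound (hp : p ∈ Set.Icc (0 : ℝ) 1) {c : ℝ} (hc0 : 0 ≤ c) (hc : c ≤ p)
    (h g : ℕ) (hn : 2 * h + 3 ≤ n) (hg : 2 * g ≤ n) :
    Pr p (Bad n) ≤ p ^ (g * g) + (n : ℝ) ^ 3 * (2 * (1 - p) ^ 2 * p ^ (h * h) +
      (n : ℝ) ^ (2 * h) * (1 - c ^ 3) ^ (n - 3 - 2 * h)) := by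
  classical
  obtain ⟨Y, -, Z, -, hYZ, hYc, hZc⟩ := two_subsets (Finset.univ : Finset (Fin n)) g g (by
    rw [Finset.card_univ, Fintype.card_fin]; omega)
  let T : Finset (Fin n × Fin n × Fin n) := Finset.univ.filter (fun q => q.1 ≠ q.2.1 ∧ q.1 ≠ q.2.2 ∧
    q.2.1 ≠ q.2.2)
  have hsub : Bad n ⊆ {ω | ∀ i ∈ btw Y Z, ω i = true} ∪ {ω | ∃ q ∈ T, ω ∈ badT q.1 q.2.1 q.2.2} := by
    intro ω hω
    by_contra hcon
    simp only [Set.mem_union, Set.mem_ofPred_eq, not_or, not_exists, not_and, not_forall] at hcon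
    obtain ⟨⟨i, hi, hi'⟩, hT⟩ := hcon
    simp only [btw, Finset.mem_image, Finset.mem_product, Prod.exists] at hi
    obtain ⟨y, z, ⟨hy, hz⟩, rfl⟩ := hi
    have hyz : y ≠ z := fun e => Finset.disjoint_left.1 hYZ hy (e ▸ hz)
    refine hω (dense_det ω hyz (by simpa using hi') ?_)
    intro v h1 h2
    exact hT (y, z, v) (by simp [T, hyz, h1, h2])
  refine (Pr_mono hp hsub).trans ((Pr_union hp _ _).trans (add_le_add ?_ ?_))
  · rw [Pr_true, card_btw hYZ, hYc, hZc]
  · have hB0 : 0 ≤ 2 * (1 - p) ^ 2 * p ^ (h * h) +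
      (n : ℝ) ^ (2 * h) * (1 - c ^ 3) ^ (n - 3 - 2 * h) := by
      have h1 : c ^ 3 ≤ 1 := pow_le_one₀ hc0 (hc.trans hp.2)
      have h2 := hp.1
      have h3 : 0 ≤ 1 - c ^ 3 := by linarith
      positivity
    refine (Pr_biUnion_le hp T (fun q => badT q.1 q.2.1 q.2.2) _ (fun ω hω => hω) _ ?_).trans
      (mul_le_mul_of_nonneg_right ?_ hB0)
    · rintro ⟨a, b, v⟩ hq
      simp only [T, Finset.mem_filter, Finset.mem_univ, true_and] at hq
      exact Pr_badT hp hc0 hc hq.1 hq.2.1 hq.2.2 h hn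
    · have : T.card ≤ n * (n * n) := by
        refine (Finset.card_le_univ T).trans ?_
        simp [Fintype.card_prod]
      calc (T.card : ℝ) ≤ ((n * (n * n) : ℕ) : ℝ) := by exact_mod_cast this
        _ = (n : ℝ) ^ 3 := by push_cast; ring

end dense
end RFib

namespace RFib

lemma sq_exp_le {u : ℝ} (hu : 0 ≤ u) : u ^ 2 * Real.exp (-u) ≤ 2 := by
  have h1 := Real.quadratic_le_exp_of_nonneg hu
  rw [Real.exp_neg, ← div_eq_mul_inv, div_le_iff₀ (Real.exp_pos u)]
  nlinarith

lemma pow_le_exp_neg {p : ℝ} (hp : p ∈ Set.Icc (0 : ℝ) 1) (m : ℕ) :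
    p ^ m ≤ Real.exp (-((1 - p) * m)) := by
  have h1 : p ≤ Real.exp (-(1 - p)) := by
    have := Real.add_one_le_exp (-(1 - p)); linarith
  calc p ^ m ≤ Real.exp (-(1 - p)) ^ m := pow_le_pow_left₀ hp.1 h1 m
    _ = _ := by rw [← Real.exp_nat_mul]; ring_nf

lemma dense_asym (p : ℕ → ℝ) (hp01 : ∀ n : ℕ, p n ∈ Set.Icc (0 : ℝ) 1)
    (hp2 : Tendsto (fun n : ℕ => (n : ℝ) ^ 2 * (1 - p n)) atTop atTop) (c : ℝ) (hc : 0 < c)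
    (δ : ℝ) (hδ : 0 < δ) : ∀ᶠ n in atTop, c ≤ p n → Pr (p n) (Bad n) ≤ δ := by
  by_cases hc1 : c ≤ 1
  swap
  · exact Eventually.of_forall fun n h => absurd (h.trans (hp01 n).2) hc1
  set κ := c ^ 3 with hκ
  have hκ0 : 0 < κ := by positivity
  have hκ1 : κ ≤ 1 := pow_le_one₀ hc.le hc1
  have t1 : Tendsto (fun n : ℕ => Real.exp (-((n : ℝ) ^ 2 * (1 - p n) / 16))) atTop (nhds 0) :=
    Real.tendsto_exp_neg_atTop_nhds_zero.comp (hp2.atTop_div_const (by norm_num))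
  have t2 : Tendsto (fun n : ℕ => 4 * (n : ℝ) ^ (-(1 / 5) : ℝ)) atTop (nhds 0) := by
    have := ((tendsto_rpow_neg_atTop (y := 1 / 5) (by norm_num)).comp
      tendsto_natCast_atTop_atTop).const_mul (4 : ℝ)
    simpa using this
  have t3 : Tendsto (fun n : ℕ => Real.exp (-(κ / 4 * (n : ℝ)))) atTop (nhds 0) :=
    Real.tendsto_exp_neg_atTop_nhds_zero.comp
      (tendsto_natCast_atTop_atTop.const_mul_atTop (by positivity))
  have tt := (t1.add t2).add t3
  simp only [add_zero] at tt
  have ev := tt.eventually (eventually_le_nhds hδ)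
  have ev2 : ∀ᶠ n : ℕ in atTop, Real.log n ≤ κ / 28 * (n : ℝ) ^ (1 / 5 : ℝ) := by
    have := (isLittleO_log_rpow_atTop (r := 1 / 5) (by norm_num)).bound (c := κ / 28) (by positivity)
    have := tendsto_natCast_atTop_atTop.eventually this
    filter_upwards [this] with n hn
    refine (le_abs_self _).trans ?_
    rw [← Real.norm_eq_abs]
    refine hn.trans (le_of_eq ?_)
    rw [Real.norm_of_nonneg (by positivity)]
  have ev3 : ∀ᶠ n : ℕ in atTop, 1 ≤ Real.log n :=
    (Real.tendsto_log_atTop.comp tendsto_natCast_atTop_atTop).eventually_ge_atTop 1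
  filter_upwards [ev, ev2, ev3, eventually_ge_atTop 2] with n hn hlog hlog1 hn2 hcp
  refine le_trans ?_ hn
  have hp := hp01 n
  have hn0 : (0 : ℝ) < n := by positivity
  have hn1 : (1 : ℝ) ≤ n := by exact_mod_cast (by omega : 1 ≤ n)
  set x : ℝ := (n : ℝ) ^ (4 / 5 : ℝ) with hx
  have hx1 : 1 ≤ x := Real.one_le_rpow hn1 (by norm_num)
  set h : ℕ := ⌈x⌉₊ with hh
  have hh1 : x ≤ h := Nat.le_ceil x
  have hh2 : (h : ℝ) ≤ 2 * x := by
    have := (Nat.ceil_lt_add_one (by linarith : 0 ≤ x)).le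
    linarith
  have hmain : 7 * x * Real.log n ≤ κ / 4 * n := by
    have e : x * (n : ℝ) ^ (1 / 5 : ℝ) = n := by
      rw [hx, ← Real.rpow_add hn0]; norm_num
    have := mul_le_mul_of_nonneg_left hlog (by linarith : 0 ≤ 7 * x)
    nlinarith
  have hxn : 7 * x ≤ κ / 4 * n := by nlinarith
  have hxn' : 7 * x ≤ n / 4 := by nlinarith
  have h2h : 2 * (h : ℝ) + 3 ≤ 7 * x := by linarith
  have hnat : 2 * h + 3 ≤ n := by
    have : (2 * h + 3 : ℝ) ≤ n := by linarith
    exact_mod_cast this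
  refine (dense_bound hp hc.le hcp h (n / 2) hnat (by omega)).trans ?_
  rw [mul_add, ← add_assoc]
  have hq0 : 0 ≤ 1 - p n := by linarith [hp.2]
  refine add_le_add (add_le_add ?_ ?_) ?_
  · refine (pow_le_exp_neg hp _).trans ?_
    rw [Real.exp_le_exp, neg_le_neg_iff]
    have h1 : (n : ℝ) ≤ 4 * ((n / 2 : ℕ) : ℝ) := by exact_mod_cast (by omega : n ≤ 4 * (n / 2))
    have h2 : (n : ℝ) ^ 2 ≤ 16 * (((n / 2 : ℕ) : ℝ) * ((n / 2 : ℕ) : ℝ)) := by nlinarith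
    push_cast
    have := mul_le_mul_of_nonneg_left h2 hq0
    push_cast at this
    linarith
  · have h1 := pow_le_exp_neg hp (h * h)
    have hh0 : (0 : ℝ) < h := by linarith
    have h2 := sq_exp_le (u := (1 - p n) * ((h * h : ℕ) : ℝ)) (by positivity)
    have h3 : (1 - p n) ^ 2 * p n ^ (h * h) ≤ 2 / (h : ℝ) ^ 4 := by
      rw [le_div_iff₀ (by positivity)]
      calc (1 - p n) ^ 2 * p n ^ (h * h) * (h : ℝ) ^ 4 ≤
          (1 - p n) ^ 2 * Real.exp (-((1 - p n) * ((h * h : ℕ) : ℝ))) * (h : ℝ) ^ 4 := by gcongr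
        _ = ((1 - p n) * ((h * h : ℕ) : ℝ)) ^ 2 * Real.exp (-((1 - p n) * ((h * h : ℕ) : ℝ))) := by
          push_cast; ring
        _ ≤ 2 := h2
    have h4 : (n : ℝ) ^ (16 / 5 : ℝ) ≤ (h : ℝ) ^ 4 := by
      calc (n : ℝ) ^ (16 / 5 : ℝ) = x ^ 4 := by
            rw [hx, ← Real.rpow_natCast, ← Real.rpow_mul hn0.le]; norm_num
        _ ≤ _ := pow_le_pow_left₀ (by linarith) hh1 4
    have h5 : 2 / (h : ℝ) ^ 4 ≤ 2 / (n : ℝ) ^ (16 / 5 : ℝ) := by gcongr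
    calc (n : ℝ) ^ 3 * (2 * (1 - p n) ^ 2 * p n ^ (h * h))
        = 2 * (n : ℝ) ^ 3 * ((1 - p n) ^ 2 * p n ^ (h * h)) := by ring
      _ ≤ 2 * (n : ℝ) ^ 3 * (2 / (n : ℝ) ^ (16 / 5 : ℝ)) := by gcongr; exact h3.trans h5
      _ = 4 * ((n : ℝ) ^ (3 : ℝ) / (n : ℝ) ^ (16 / 5 : ℝ)) := by
          rw [show (n : ℝ) ^ (3 : ℝ) = (n : ℝ) ^ (3 : ℕ) by rw [← Real.rpow_natCast]; norm_num]
          ring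
      _ = 4 * (n : ℝ) ^ (-(1 / 5) : ℝ) := by
          rw [← Real.rpow_sub hn0]; norm_num
  · have h1 := pow_le_exp_neg (p := 1 - κ) ⟨by linarith, by linarith⟩ (n - 3 - 2 * h)
    rw [sub_sub_cancel] at h1
    have h2 : ((n - 3 - 2 * h : ℕ) : ℝ) = n - 3 - 2 * h := by
      rw [Nat.cast_sub (by omega), Nat.cast_sub (by omega)]; push_cast; ring
    rw [h2] at h1
    calc (n : ℝ) ^ 3 * ((n : ℝ) ^ (2 * h) * (1 - κ) ^ (n - 3 - 2 * h))
        ≤ (n : ℝ) ^ 3 * ((n : ℝ) ^ (2 * h) * Real.exp (-(κ * (n - 3 - 2 * h)))) := by gcongr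
      _ = Real.exp (Real.log n * (3 + 2 * h : ℕ) + (-(κ * (n - 3 - 2 * h)))) := by
          rw [Real.exp_add, ← Real.rpow_def_of_pos hn0, Real.rpow_natCast, pow_add]; ring
      _ ≤ _ := by
          rw [Real.exp_le_exp]
          push_cast
          have h3 : Real.log n * (3 + 2 * h) ≤ κ / 4 * n := by
            have : Real.log n * (3 + 2 * h) ≤ Real.log n * (7 * x) :=
              mul_le_mul_of_nonneg_left (by linarith) (by linarith)
            linarith
          nlinarith

end RFib

namespace RFib

section sparse
variable {n : ℕ} {p : ℝ}

/-- pick a subset of size `s` -/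
noncomputable def pick {α : Type*} (S : Finset α) (s : ℕ) : Finset α :=
  if h : s ≤ S.card then (Finset.exists_subset_card_eq h).choose else ∅

lemma pick_sub {α : Type*} (S : Finset α) (s : ℕ) : pick S s ⊆ S := by
  unfold pick
  split_ifs with h
  · exact (Finset.exists_subset_card_eq h).choose_spec.1
  · exact Finset.empty_subset _

lemma pick_card {α : Type*} {S : Finset α} {s : ℕ} (h : s ≤ S.card) : (pick S s).card = s := by
  unfold pick
  rw [dif_pos h]
  exact (Finset.exists_subset_card_eq h).choose_spec.2

lemma pick_card_le {α : Type*} (S : Finset α) (s : ℕ) : (pick S s).card ≤ s := by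
  by_cases h : s ≤ S.card
  · exact (pick_card h).le
  · simp [pick, h]

lemma pc_sub {α : Type*} {S : Finset α} {k : ℕ} : S.powersetCard k ⊆ S.powerset :=
  fun _ hX => Finset.mem_powerset.2 (Finset.mem_powersetCard.1 hX).1

/-- non-neighbours -/
def NN (W : Bool → Bool → Finset (Fin n)) (b : Bool) (ω : Sym2 (Fin n) → Bool) : Finset (Fin n) :=
  (W b false).filter (fun y => ∀ a ∈ W b true, ω s(y, a) = false)

/-- the four lists -/
noncomputable def LL (W : Bool → Bool → Finset (Fin n)) (s : ℕ) (ω : Sym2 (Fin n) → Bool) (b c : Bool) :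
    Finset (Fin n) := if c = true then W b true else pick (NN W b ω) s

lemma LL_sub (W : Bool → Bool → Finset (Fin n)) (s : ℕ) (ω : Sym2 (Fin n) → Bool) (b c : Bool) :
    LL W s ω b c ⊆ W b c := by
  unfold LL
  cases c
  · exact (pick_sub (NN W b ω) s).trans (Finset.filter_subset _ _)
  · simp

lemma Pr_NN (hp : p ∈ Set.Icc (0 : ℝ) 1) (W : Bool → Bool → Finset (Fin n)) (b : Bool) (s j : ℕ)
    (hd : Disjoint (W b false) (W b true)) (hA : (W b true).card = s) (hY : (W b false).card = s + j) :
    Pr p {ω | (NN W b ω).card < s} ≤ ((s + j).choose j) * (1 - (1 - p) ^ s) ^ j := by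
  have h1 := Pr_tail hp (W b false) (fun u => btw {u} (W b true))
    (fun u => {ω | ∀ i ∈ btw {u} (W b true), ω i = false}ᶜ)
    (fun u hu u' _ huu' => btw_disj huu' (Finset.disjoint_left.1 hd hu))
    (fun u _ ω ω' hω hu hu' => hu (fun i hi => by rw [hω i hi]; exact hu' i hi))
    (1 - (1 - p) ^ s)
    (by
      intro u hu
      rw [Pr_compl, Pr_false, card_btw, hA, Finset.card_singleton, one_mul]
      simpa using Finset.disjoint_left.1 hd hu) j
  rw [hY] at h1
  refine (Pr_mono hp ?_).trans h1
  intro ω hω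
  have hω : (NN W b ω).card < s := hω
  have hsub : NN W b ω ⊆ W b false := Finset.filter_subset _ _
  have := Finset.card_sdiff_add_card_eq_card hsub
  obtain ⟨Q, hQ, hQc⟩ := Finset.exists_subset_card_eq (s := W b false \ NN W b ω)
    (n := j) (by omega)
  refine ⟨Q, hQ.trans Finset.sdiff_subset, hQc, ?_⟩
  intro u hu hall
  have hu' := Finset.mem_sdiff.1 (hQ hu)
  apply hu'.2
  refine Finset.mem_filter.2 ⟨hu'.1, fun x hx => hall _ (mem_btw (Finset.mem_singleton_self _) hx)⟩

/-- property (P) -/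
def PP (W : Bool → Bool → Finset (Fin n)) (s k : ℕ) : Set (Sym2 (Fin n) → Bool) :=
  {ω | ∀ b b', ∀ X ⊆ LL W s ω false b, ∀ Y ⊆ LL W s ω true b', X.card = k → Y.card = k →
    ∃ x ∈ X, ∃ y ∈ Y, ω s(x, y) = true}

lemma Pr_PP (hp : p ∈ Set.Icc (0 : ℝ) 1) (W : Bool → Bool → Finset (Fin n)) (s k : ℕ)
    (hW : ∀ b c b' c' v, v ∈ W b c → v ∈ W b' c' → b = b' ∧ c = c')
    (hA : ∀ b, (W b true).card = s) :
    Pr p (PP W s k)ᶜ ≤ 4 * (2 : ℝ) ^ s * 2 ^ s * (1 - p) ^ (k * k) := by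
  classical
  set S : Finset (Sym2 (Fin n)) := btw (W false false) (W false true) ∪ btw (W true false) (W true true)
    with hS
  have hmem : ∀ b y a, y ∈ W b false → a ∈ W b true → s(y, a) ∈ S := by
    intro b y a hy ha
    cases b
    · exact Finset.mem_union_left _ (mem_btw hy ha)
    · exact Finset.mem_union_right _ (mem_btw hy ha)
  have hnot : ∀ c c' x y, x ∈ W false c → y ∈ W true c' → s(x, y) ∉ S := by
    intro c c' x y hx hy h
    rw [hS, Finset.mem_union] at h
    rcases h with h | h <;>
    simp only [btw, Finset.mem_image, Finset.mem_product, Prod.exists] at h <;>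
    obtain ⟨a, b, ⟨ha, hb⟩, he⟩ := h <;>
    rw [Sym2.eq_iff] at he <;>
    rcases he with ⟨rfl, rfl⟩ | ⟨rfl, rfl⟩
    · exact absurd (hW _ _ _ _ _ hb hy).1 (by simp)
    · exact absurd (hW _ _ _ _ _ ha hy).1 (by simp)
    · exact absurd (hW _ _ _ _ _ ha hx).1 (by simp)
    · exact absurd (hW _ _ _ _ _ hb hx).1 (by simp)
  have hNN : ∀ b ω ω', NN W b (mrg S ω ω') = NN W b ω := by
    intro b ω ω'
    unfold NN
    refine Finset.filter_congr fun y hy => ?_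
    refine forall₂_congr fun a ha => ?_
    rw [mrg_in (hmem b y a hy ha)]
  have hLL : ∀ ω ω', LL W s (mrg S ω ω') = LL W s ω := by
    intro ω ω'
    funext b c
    unfold LL
    rw [hNN]
  have hLc : ∀ ω b c, (LL W s ω b c).card ≤ s := by
    intro ω b c
    unfold LL
    split_ifs
    · exact (hA b).le
    · exact pick_card_le _ _
  have hq0 : 0 ≤ 1 - p := by linarith [hp.2]
  refine Pr_cond' hp S _ _ fun ω => ?_
  let I : Finset ((Bool × Bool) × (Finset (Fin n) × Finset (Fin n))) :=
    Finset.univ.biUnion (fun q : Bool × Bool => {q} ×ˢ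
      ((LL W s ω false q.1).powersetCard k ×ˢ (LL W s ω true q.2).powersetCard k))
  have hI : (I.card : ℝ) ≤ 4 * (2 : ℝ) ^ s * 2 ^ s := by
    have h1 : I.card ≤ (Finset.univ : Finset (Bool × Bool)).card * (2 ^ s * 2 ^ s) := by
      refine Finset.card_biUnion_le_card_mul _ _ _ fun q _ => ?_
      rw [Finset.card_product, Finset.card_singleton, one_mul, Finset.card_product]
      refine Nat.mul_le_mul ?_ ?_
      · refine (Finset.card_le_card pc_sub).trans ?_
        rw [Finset.card_powerset]
        exact Nat.pow_le_pow_right (by norm_num) (hLc _ _ _)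
      · refine (Finset.card_le_card pc_sub).trans ?_
        rw [Finset.card_powerset]
        exact Nat.pow_le_pow_right (by norm_num) (hLc _ _ _)
    have h2 : (Finset.univ : Finset (Bool × Bool)).card = 4 := by simp [Fintype.card_prod]
    rw [h2] at h1
    calc (I.card : ℝ) ≤ ((4 * (2 ^ s * 2 ^ s) : ℕ) : ℝ) := by exact_mod_cast h1
      _ = _ := by push_cast; ring
  refine (Pr_biUnion_le hp I (fun r => {ω' | ∀ i ∈ btw r.2.1 r.2.2, ω' i = false}) _ ?_
    ((1 - p) ^ (k * k)) ?_).trans (mul_le_mul_of_nonneg_right hI (pow_nonneg hq0 _))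
  · intro ω' hω'
    have hω' : mrg S ω ω' ∉ PP W s k := hω'
    simp only [PP, Set.mem_ofPred_eq, hLL] at hω'
    push Not at hω'
    obtain ⟨b, b', X, hX, Y, hY, hXc, hYc, hXY⟩ := hω'
    refine ⟨((b, b'), (X, Y)), ?_, ?_⟩
    · simp only [I, Finset.mem_biUnion, Finset.mem_univ, true_and, Finset.mem_product,
        Finset.mem_singleton, Finset.mem_powersetCard]
      exact ⟨(b, b'), rfl, ⟨hX, hXc⟩, hY, hYc⟩
    · intro i hi
      simp only [btw, Finset.mem_image, Finset.mem_product, Prod.exists] at hi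
      obtain ⟨x, y, ⟨hx, hy⟩, rfl⟩ := hi
      have := hXY x hx y hy
      rw [mrg_out (hnot b b' x y (LL_sub _ _ _ _ _ (hX hx)) (LL_sub _ _ _ _ _ (hY hy)))] at this
      simpa using this
  · rintro ⟨⟨b, b'⟩, X, Y⟩ hr
    simp only [I, Finset.mem_biUnion, Finset.mem_univ, true_and, Finset.mem_product,
        Finset.mem_singleton, Finset.mem_powersetCard] at hr
    obtain ⟨q, rfl, ⟨hX, hXc⟩, hY, hYc⟩ := hr
    have hdis : Disjoint X Y := by
      rw [Finset.disjoint_left]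
      intro v h1 h2
      exact absurd (hW _ _ _ _ _ (LL_sub _ _ _ _ _ (hX h1)) (LL_sub _ _ _ _ _ (hY h2))).1 (by simp)
    dsimp only
    rw [Pr_noedge hdis, hXc, hYc]

/-- expansion between `R` and its complement -/
def EE (R : Finset (Fin n)) (k m : ℕ) : Set (Sym2 (Fin n) → Bool) :=
  {ω | ∀ X ⊆ R, ∀ Y ⊆ Finset.univ \ R, X.card = k → Y.card = m → ∃ x ∈ X, ∃ y ∈ Y, ω s(x, y) = true}

lemma Pr_EE (hp : p ∈ Set.Icc (0 : ℝ) 1) (R : Finset (Fin n)) (k m : ℕ) :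
    Pr p (EE R k m)ᶜ ≤ (2 : ℝ) ^ n * 2 ^ n * (1 - p) ^ (k * m) := by
  classical
  have hq0 : 0 ≤ 1 - p := by linarith [hp.2]
  let I : Finset (Finset (Fin n) × Finset (Fin n)) :=
    R.powersetCard k ×ˢ (Finset.univ \ R).powersetCard m
  have hI : (I.card : ℝ) ≤ (2 : ℝ) ^ n * 2 ^ n := by
    have h1 : ∀ J : Finset (Fin n), ∀ k, (J.powersetCard k).card ≤ 2 ^ n := by
      intro J k
      refine (Finset.card_le_card pc_sub).trans ?_
      rw [Finset.card_powerset]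
      exact Nat.pow_le_pow_right (by norm_num) (by simpa using Finset.card_le_univ J)
    have h2 : I.card ≤ 2 ^ n * 2 ^ n := by
      rw [Finset.card_product]; exact Nat.mul_le_mul (h1 _ _) (h1 _ _)
    exact_mod_cast h2
  refine (Pr_biUnion_le hp I (fun r => {ω' | ∀ i ∈ btw r.1 r.2, ω' i = false}) _ ?_
    ((1 - p) ^ (k * m)) ?_).trans (mul_le_mul_of_nonneg_right hI (pow_nonneg hq0 _))
  · intro ω hω
    have hω : ω ∉ EE R k m := hω
    simp only [EE, Set.mem_ofPred_eq] at hω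
    push Not at hω
    obtain ⟨X, hX, Y, hY, hXc, hYc, hXY⟩ := hω
    refine ⟨(X, Y), by simp only [I, Finset.mem_product, Finset.mem_powersetCard]; exact ⟨⟨hX, hXc⟩, hY, hYc⟩, ?_⟩
    intro i hi
    simp only [btw, Finset.mem_image, Finset.mem_product, Prod.exists] at hi
    obtain ⟨x, y, ⟨hx, hy⟩, rfl⟩ := hi
    simpa using hXY x hx y hy
  · rintro ⟨X, Y⟩ hr
    simp only [I, Finset.mem_product, Finset.mem_powersetCard] at hr
    obtain ⟨⟨hX, hXc⟩, hY, hYc⟩ := hr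
    have hdis : Disjoint X Y := by
      rw [Finset.disjoint_left]
      intro v h1 h2
      exact (Finset.mem_sdiff.1 (hY h2)).2 (hX h1)
    dsimp only
    rw [Pr_noedge hdis, hXc, hYc]

/-- neighbours inside `T` -/
def nb (ω : Sym2 (Fin n) → Bool) (T : Finset (Fin n)) (x : Fin n) : Finset (Fin n) :=
  T.filter (fun y => y ≠ x ∧ ω s(x, y) = true)

lemma Pr_deg (hp : p ∈ Set.Icc (0 : ℝ) 1) (d : ℕ) :
    Pr p {ω : Sym2 (Fin n) → Bool | ∀ x, (nb ω Finset.univ x).card ≤ d}ᶜ ≤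
      n * ((n.choose (d + 1)) * p ^ (d + 1)) := by
  classical
  have h1 : ∀ v ∈ (Finset.univ : Finset (Fin n)), Pr p {ω : Sym2 (Fin n) → Bool | ∃ Q ⊆ Finset.univ \ {v},
      Q.card = d + 1 ∧ ∀ u ∈ Q, ω ∈ {ω : Sym2 (Fin n) → Bool | ω s(v, u) = true}} ≤
      (n.choose (d + 1)) * p ^ (d + 1) := by
    intro v _
    refine (Pr_tail hp (Finset.univ \ {v}) (fun u => {s(v, u)}) (fun u => {ω | ω s(v, u) = true})
      ?_ ?_ p ?_ (d + 1)).trans ?_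
    · intro a ha b hb hab
      rw [Finset.disjoint_singleton]
      intro he
      rw [Sym2.eq_iff] at he
      rcases he with ⟨-, h⟩ | ⟨h, h'⟩
      · exact hab h
      · exact hab (h'.trans h)
    · intro a _ ω ω' hω h
      have h : ω s(v, a) = true := h
      change ω' s(v, a) = true
      rw [← hω _ (Finset.mem_singleton_self _)]; exact h
    · intro a _
      have := Pr_true (p := p) ({s(v, a)} : Finset (Sym2 (Fin n)))
      simp only [Finset.mem_singleton, forall_eq, Finset.card_singleton, pow_one] at this
      exact this.le
    · refine mul_le_mul_of_nonneg_right ?_ (pow_nonneg hp.1 _)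
      have : (Finset.univ \ {v}).card ≤ n := by simpa using Finset.card_le_univ (Finset.univ \ {v})
      exact_mod_cast Nat.choose_le_choose _ this
  have h2 := Pr_biUnion_le hp (Finset.univ : Finset (Fin n)) _
    {ω : Sym2 (Fin n) → Bool | ∀ x, (nb ω Finset.univ x).card ≤ d}ᶜ ?_ _ h1
  · simpa using h2
  · intro ω hω
    have hω : ¬ ∀ x, (nb ω Finset.univ x).card ≤ d := hω
    push Not at hω
    obtain ⟨x, hx⟩ := hω
    obtain ⟨Q, hQ, hQc⟩ := Finset.exists_subset_card_eq (s := nb ω Finset.univ x) (n := d + 1) (by omega)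
    refine ⟨x, Finset.mem_univ _, Q, ?_, hQc, ?_⟩
    · intro u hu
      have := (Finset.mem_filter.1 (hQ hu)).2.1
      simpa using this
    · intro u hu
      exact (Finset.mem_filter.1 (hQ hu)).2.2

/-- neighbourhoods in `T` are cliques -/
def CQ (T : Finset (Fin n)) (ω ω' : Sym2 (Fin n) → Bool) (z : Fin n) : Prop :=
  ∀ x ∈ T, ∀ y ∈ T, x ≠ y → ω' s(z, x) = true → ω' s(z, y) = true → ω s(x, y) = true

lemma Pr_CQ_one (hp : p ∈ Set.Icc (0 : ℝ) 1) (T : Finset (Fin n)) (z : Fin n) (hz : z ∉ T) (d t : ℕ)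
    (ht : t ≤ T.card) (ω : Sym2 (Fin n) → Bool) (hω : ∀ x ∈ T, (nb ω T x).card ≤ d) :
    Pr p {ω' | CQ T ω ω' z} ≤ (1 + n * p) * (1 - p) ^ (t - 1 - d) := by
  classical
  have hq0 : 0 ≤ 1 - p := by linarith [hp.2]
  have hq1 : 1 - p ≤ 1 := by linarith [hp.1]
  have hsub : {ω' | CQ T ω ω' z} ⊆ {ω' | ∀ i ∈ btw {z} T, ω' i = false} ∪
      {ω' | ∃ x ∈ T, ω' ∈ {ω' : Sym2 (Fin n) → Bool | (∀ i ∈ ({s(z, x)} : Finset (Sym2 (Fin n))), ω' i = true) ∧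
        ∀ i ∈ btw {z} (T \ insert x (nb ω T x)), ω' i = false}} := by
    intro ω' h
    have h : CQ T ω ω' z := h
    by_cases hx : ∃ x ∈ T, ω' s(z, x) = true
    · right
      obtain ⟨x, hxT, hx⟩ := hx
      refine ⟨x, hxT, by simpa using hx, ?_⟩
      intro i hi
      simp only [btw, Finset.mem_image, Finset.mem_product, Finset.mem_singleton, Prod.exists] at hi
      obtain ⟨a, y, ⟨rfl, hy⟩, rfl⟩ := hi
      rw [Finset.mem_sdiff, Finset.mem_insert, not_or] at hy
      by_contra hcon
      have hcon : ω' s(a, y) = true := by simpa using hcon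
      apply hy.2.2
      exact Finset.mem_filter.2 ⟨hy.1, hy.2.1, h x hxT y hy.1 (Ne.symm hy.2.1) hx hcon⟩
    · left
      push Not at hx
      intro i hi
      simp only [btw, Finset.mem_image, Finset.mem_product, Finset.mem_singleton, Prod.exists] at hi
      obtain ⟨a, y, ⟨rfl, hy⟩, rfl⟩ := hi
      simpa using hx y hy
  refine (Pr_mono hp hsub).trans ((Pr_union hp _ _).trans ?_)
  have h1 : Pr p {ω' : Sym2 (Fin n) → Bool | ∀ i ∈ btw {z} T, ω' i = false} ≤ (1 - p) ^ (t - 1 - d) := by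
    rw [Pr_noedge (by simpa using hz), Finset.card_singleton, one_mul]
    exact pow_le_pow_of_le_one hq0 hq1 (by omega)
  have h2 := Pr_biUnion_le hp T (fun x => {ω' : Sym2 (Fin n) → Bool | (∀ i ∈ ({s(z, x)} : Finset (Sym2 (Fin n))), ω' i = true) ∧
        ∀ i ∈ btw {z} (T \ insert x (nb ω T x)), ω' i = false}) _ (fun ω' h => h) (p * (1 - p) ^ (t - 1 - d)) (by
      intro x hx
      have hc1 : (insert x (nb ω T x)).card ≤ d + 1 :=
        (Finset.card_insert_le _ _).trans (by have := hω x hx; omega)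
      have hc2 := Finset.le_card_sdiff (insert x (nb ω T x)) T
      rw [Pr_cyl, Finset.card_singleton, pow_one, card_btw, Finset.card_singleton, one_mul]
      · exact mul_le_mul_of_nonneg_left (pow_le_pow_of_le_one hq0 hq1 (by omega)) hp.1
      · simp [hz]
      · rw [Finset.disjoint_singleton_left]
        intro hi
        simp only [btw, Finset.mem_image, Finset.mem_product, Finset.mem_singleton, Prod.exists] at hi
        obtain ⟨a, y, ⟨rfl, hy⟩, he⟩ := hi
        rw [Finset.mem_sdiff, Finset.mem_insert, not_or] at hy
        rw [Sym2.eq_iff] at he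
        rcases he with ⟨-, h⟩ | ⟨h, h'⟩
        · exact hy.2.1 h
        · exact hz (h ▸ hx))
  have hTn : (T.card : ℝ) ≤ n := by
    have : T.card ≤ n := by simpa using Finset.card_le_univ T
    exact_mod_cast this
  have h3 : (T.card : ℝ) * (p * (1 - p) ^ (t - 1 - d)) ≤ n * (p * (1 - p) ^ (t - 1 - d)) :=
    mul_le_mul_of_nonneg_right hTn (mul_nonneg hp.1 (pow_nonneg hq0 _))
  have h4 : (1 + n * p) * (1 - p) ^ (t - 1 - d) =
    (1 - p) ^ (t - 1 - d) + n * (p * (1 - p) ^ (t - 1 - d)) := by ring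
  rw [h4]
  exact add_le_add h1 (h2.trans h3)

lemma Pr_CQ (hp : p ∈ Set.Icc (0 : ℝ) 1) (T Z : Finset (Fin n)) (hZT : Disjoint Z T) (d t : ℕ)
    (ht : t ≤ T.card) :
    Pr p {ω | (∀ z ∈ Z, CQ T ω ω z) ∧ ∀ x ∈ T, (nb ω T x).card ≤ d} ≤
      ((1 + n * p) * (1 - p) ^ (t - 1 - d)) ^ Z.card := by
  classical
  have hq0 : 0 ≤ 1 - p := by linarith [hp.2]
  have hp0 := hp.1
  refine Pr_cond' hp (btw T T) _ _ fun ω => ?_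
  have hnb : ∀ ω' x, x ∈ T → nb (mrg (btw T T) ω ω') T x = nb ω T x := by
    intro ω' x hx
    unfold nb
    refine Finset.filter_congr fun y hy => ?_
    rw [mrg_in (mem_btw hx hy)]
  by_cases hω : ∀ x ∈ T, (nb ω T x).card ≤ d
  · refine (Pr_mono hp (F := {ω' | ∀ z ∈ Z, ω' ∈ {ω' | CQ T ω ω' z}}) ?_).trans
      (Pr_biInter_le hp Z (fun z => btw {z} T) (fun z => {ω' | CQ T ω ω' z}) ?_ ?_ _ ?_)
    · rintro ω' ⟨h, -⟩ z hz x hx y hy hxy h1 h2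
      have hzT := Finset.disjoint_left.1 hZT hz
      have hzn : ∀ y, s(z, y) ∉ btw T T := by
        intro y hi
        simp only [btw, Finset.mem_image, Finset.mem_product, Prod.exists] at hi
        obtain ⟨a, b, ⟨ha, hb⟩, he⟩ := hi
        rw [Sym2.eq_iff] at he
        rcases he with ⟨rfl, rfl⟩ | ⟨rfl, rfl⟩
        · exact hzT ha
        · exact hzT hb
      have := h z hz x hx y hy hxy (by rw [mrg_out (hzn x)]; exact h1) (by rw [mrg_out (hzn y)]; exact h2)
      rwa [mrg_in (mem_btw hx hy)] at this
    · intro a ha b hb hab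
      exact btw_disj hab (Finset.disjoint_left.1 hZT ha)
    · intro z hz ω₁ ω₂ h12 h x hx y hy hxy h1 h2
      refine h x hx y hy hxy ?_ ?_
      · rw [h12 _ (mem_btw (Finset.mem_singleton_self _) hx)]; exact h1
      · rw [h12 _ (mem_btw (Finset.mem_singleton_self _) hy)]; exact h2
    · intro z hz
      exact Pr_CQ_one hp T z (Finset.disjoint_left.1 hZT hz) d t ht ω hω
  · have : {ω' | mrg (btw T T) ω ω' ∈ {ω : Sym2 (Fin n) → Bool | (∀ z ∈ Z, CQ T ω ω z) ∧ ∀ x ∈ T, (nb ω T x).card ≤ d}} = ∅ := by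
      ext ω'
      simp only [Set.mem_ofPred_eq, Set.mem_empty_iff_false, iff_false]
      rintro ⟨-, h2⟩
      exact hω fun x hx => by rw [← hnb ω' x hx]; exact h2 x hx
    rw [this, Pr_empty]
    positivity

end sparse
end RFib

namespace RFib

section sparse2
variable {n : ℕ} {p : ℝ}

/-- union of the four blocks -/
def RR (W : Bool → Bool → Finset (Fin n)) : Finset (Fin n) :=
  Finset.univ.biUnion (fun q : Bool × Bool => W q.1 q.2)

lemma mem_RR {W : Bool → Bool → Finset (Fin n)} {b c : Bool} {v : Fin n} (h : v ∈ W b c) : v ∈ RR W :=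
  Finset.mem_biUnion.2 ⟨(b, c), Finset.mem_univ _, h⟩

/-- the bad clique event -/
def ZZ (W : Bool → Bool → Finset (Fin n)) (d : ℕ) (Z : Finset (Fin n)) : Set (Sym2 (Fin n) → Bool) :=
  {ω | (∀ z ∈ Z, CQ (Finset.univ \ (Z ∪ RR W)) ω ω z) ∧
    ∀ x ∈ Finset.univ \ (Z ∪ RR W), (nb ω (Finset.univ \ (Z ∪ RR W)) x).card ≤ d}

lemma sparse_det (ω : Sym2 (Fin n) → Bool) (W : Bool → Bool → Finset (Fin n)) (k m d : ℕ) (hk : 0 < k)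
    (hW : ∀ b c b' c' v, v ∈ W b c → v ∈ W b' c' → b = b' ∧ c = c')
    (hA : ∀ b, (W b true).card = 4 * k) (hN : ∀ b, 4 * k ≤ (NN W b ω).card)
    (hP : ω ∈ PP W (4 * k) k) (hE : ω ∈ EE (RR W) k m) (hn : 4 * ((RR W).card + 2 * m) ≤ n)
    (hdeg : ∀ x, (nb ω Finset.univ x).card ≤ d)
    (hZ : ∀ Z : Finset (Fin n), Z.Nonempty → 4 * Z.card ≤ n → ω ∉ ZZ W d Z) :
    VirtuallyAlgebraicallyFibers (RACG (graphOf ω)) := by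
  classical
  have hadj : ∀ b c x y, x ∈ W false b → y ∈ W true c → ω s(x, y) = true → (graphOf ω).Adj x y := by
    intro b c x y hx hy h
    refine (adj_iff ?_).2 h
    rintro rfl
    exact absurd (hW _ _ _ _ _ hx hy).1 (by simp)
  have hP1 : ∀ b b', ∀ X ⊆ LL W (4 * k) ω false b, ∀ Y ⊆ LL W (4 * k) ω true b', k ≤ X.card → k ≤ Y.card →
      ∃ x ∈ X, ∃ y ∈ Y, (graphOf ω).Adj x y := by
    intro b b' X hX Y hY hXc hYc
    obtain ⟨X', hX', hX'c⟩ := Finset.exists_subset_card_eq hXc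
    obtain ⟨Y', hY', hY'c⟩ := Finset.exists_subset_card_eq hYc
    obtain ⟨x, hx, y, hy, hxy⟩ := hP b b' X' (hX'.trans hX) Y' (hY'.trans hY) hX'c hY'c
    exact ⟨x, hX' hx, y, hY' hy, hadj b b' x y (LL_sub _ _ _ _ _ (hX (hX' hx)))
      (LL_sub _ _ _ _ _ (hY (hY' hy))) hxy⟩
  have hLcard : ∀ s b, (LL W (4 * k) ω s b).card = 4 * k := by
    intro s b
    unfold LL
    split_ifs
    · exact hA s
    · exact pick_card (hN s)
  obtain ⟨L', hL', hbip⟩ := prune (G := graphOf ω) (LL W (4 * k) ω) k (4 * k) hk hLcard le_rfl (by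
    rintro (_ | _) b b' X hX Y hY hXc hYc
    · exact hP1 b b' X hX Y hY hXc hYc
    · obtain ⟨y, hy, x, hx, h⟩ := hP1 b' b Y hY X hX hYc hXc
      exact ⟨x, hx, y, hy, h.symm⟩)
  have hLW : ∀ s b v, v ∈ L' s b → v ∈ W s b := fun s b v hv => LL_sub _ _ _ _ _ ((hL' s b).1 hv)
  set O : Set (Fin n) := {v | v ∉ RR W} with hO
  set Cs : Bool → Bool → Set (Fin n) := fun s b => ↑(L' s b) with hCs
  have hinf : ∀ v, Inf (graphOf ω) Cs O v := by
    by_contra hcon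
    push Not at hcon
    obtain ⟨v₀, hv₀⟩ := hcon
    set Z : Finset (Fin n) := Finset.univ.filter (fun v => ¬ Inf (graphOf ω) Cs O v) with hZdef
    have hZmem : ∀ v, v ∈ Z ↔ ¬ Inf (graphOf ω) Cs O v := by intro v; simp [hZdef]
    let U : Bool → Finset (Fin n) := fun b => (Finset.univ \ RR W).filter
      (fun v => ∀ a ∈ L' false b, ω s(a, v) = false)
    have hU : ∀ b, (U b).card < m := by
      intro b
      by_contra hc
      push Not at hc
      obtain ⟨Y, hY, hYc⟩ := Finset.exists_subset_card_eq hc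
      obtain ⟨X, hX, hXc⟩ := Finset.exists_subset_card_eq (s := L' false b) (n := k) (by
        have := (hL' false b).2; omega)
      obtain ⟨x, hx, y, hy, hxy⟩ := hE X (fun x hx => mem_RR (hLW _ _ _ (hX hx))) Y
        (fun y hy => (Finset.mem_filter.1 (hY hy)).1) hXc hYc
      have := (Finset.mem_filter.1 (hY hy)).2 x (hX hx)
      rw [this] at hxy
      exact absurd hxy (by simp)
    have hZsub : Z ⊆ RR W ∪ (U true ∪ U false) := by
      intro v hv
      by_contra hc
      simp only [Finset.mem_union, not_or] at hc
      obtain ⟨h1, h2, h3⟩ := hc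
      have key : ∀ b, v ∉ U b → ∃ a ∈ L' false b, (graphOf ω).Adj v a := by
        intro b hb
        by_contra hcc
        push Not at hcc
        apply hb
        refine Finset.mem_filter.2 ⟨by simpa using h1, fun a ha => ?_⟩
        have hva : v ≠ a := by
          rintro rfl
          exact h1 (mem_RR (hLW _ _ _ ha))
        have := hcc a ha
        rw [adj_iff hva, Sym2.eq_swap] at this
        simpa using this
      obtain ⟨a, ha, hva⟩ := key true h2
      obtain ⟨b, hb, hvb⟩ := key false h3
      exact (hZmem v).1 hv (Inf.mid (a := a) (b := b) ha hb hva hvb)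
    have hZc : 4 * Z.card ≤ n := by
      have h1 := Finset.card_le_card hZsub
      have h2 := Finset.card_union_le (RR W) (U true ∪ U false)
      have h3 := Finset.card_union_le (U true) (U false)
      have h4 := hU true
      have h5 := hU false
      omega
    refine hZ Z ⟨v₀, (hZmem v₀).2 hv₀⟩ hZc ⟨?_, ?_⟩
    · intro z hz x hx y hy hxy hzx hzy
      by_contra hne
      simp only [Finset.mem_sdiff, Finset.mem_univ, true_and, Finset.mem_union, not_or, hZmem,
        not_not] at hx hy
      have hz' := (hZmem z).1 hz
      have hzx' : z ≠ x := by rintro rfl; exact hz' hx.1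
      have hzy' : z ≠ y := by rintro rfl; exact hz' hy.1
      refine hz' (Inf.out (a := x) (b := y) hx.2 hy.2 hxy ?_ hx.1 hy.1 ((adj_iff hzx').2 hzx) ((adj_iff hzy').2 hzy))
      rw [adj_iff hxy]; exact hne
    · intro x _
      refine (Finset.card_le_card ?_).trans (hdeg x)
      exact Finset.filter_subset_filter _ (Finset.subset_univ _)
  refine thmD Cs O ?_ ?_ ?_ ?_ hbip hinf
  · intro s b s' b' v h1 h2
    exact hW _ _ _ _ v (hLW _ _ _ h1) (hLW _ _ _ h2)
  · intro s b v h1 h2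
    exact h2 (mem_RR (hLW _ _ _ h1))
  · intro s u v hu hv h
    have hu' : u ∈ W s true := hLW _ _ _ hu
    have hv1 : v ∈ LL W (4 * k) ω s false := (hL' s false).1 hv
    have hv2 : v ∈ NN W s ω := by
      simp only [LL, Bool.false_eq_true, if_false] at hv1
      exact pick_sub _ _ hv1
    have := (Finset.mem_filter.1 hv2).2 u hu'
    have h' := h.symm
    rw [adj_iff h'.ne, this] at h'
    exact absurd h' (by simp)
  · intro b
    have h1 := (hL' false b).2
    have : (L' false b).Nonempty := Finset.card_pos.1 (by omega)
    exact this

lemma exists_W (s t : ℕ) (h : 2 * s + 2 * t ≤ n) : ∃ W : Bool → Bool → Finset (Fin n),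
    (∀ b c b' c' v, v ∈ W b c → v ∈ W b' c' → b = b' ∧ c = c') ∧ (∀ b, (W b true).card = s) ∧
    (∀ b, (W b false).card = t) ∧ (RR W).card ≤ 2 * s + 2 * t := by
  classical
  obtain ⟨X, -, Y, -, hXY, hXc, hYc⟩ := two_subsets (Finset.univ : Finset (Fin n)) (s + t) (s + t) (by
    rw [Finset.card_univ, Fintype.card_fin]; omega)
  obtain ⟨A, hA, B, hB, hAB, hAc, hBc⟩ := two_subsets X s t (by omega)
  obtain ⟨C, hC, D, hD, hCD, hCc, hDc⟩ := two_subsets Y s t (by omega)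
  refine ⟨fun b c => if b then (if c then A else B) else (if c then C else D), ?_, ?_, ?_, ?_⟩
  · rw [Finset.disjoint_left] at hXY hAB hCD
    rintro (_ | _) (_ | _) (_ | _) (_ | _) v h1 h2 <;> simp at h1 h2 ⊢
    · exact hCD h2 h1
    · exact hXY (hB h2) (hD h1)
    · exact hXY (hA h2) (hD h1)
    · exact hCD h1 h2
    · exact hXY (hB h2) (hC h1)
    · exact hXY (hA h2) (hC h1)
    · exact hXY (hB h1) (hD h2)
    · exact hXY (hB h1) (hC h2)
    · exact hAB h2 h1
    · exact hXY (hA h1) (hD h2)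
    · exact hXY (hA h1) (hC h2)
    · exact hAB h1 h2
  · rintro (_ | _) <;> simp [hAc, hCc]
  · rintro (_ | _) <;> simp [hBc, hDc]
  · have : RR (fun b c => if b then (if c then A else B) else (if c then C else D)) ⊆ X ∪ Y := by
      intro v hv
      obtain ⟨⟨b, c⟩, -, hv⟩ := Finset.mem_biUnion.1 hv
      rw [Finset.mem_union]
      cases b <;> cases c <;> simp at hv
      · exact Or.inr (hD hv)
      · exact Or.inr (hC hv)
      · exact Or.inl (hB hv)
      · exact Or.inl (hA hv)
    have h1 := Finset.card_le_card this
    have h2 := Finset.card_union_le X Y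
    omega

lemma sparse_bound (hp : p ∈ Set.Icc (0 : ℝ) 1) (k j m d n0 : ℕ) (hk : 0 < k)
    (hn0 : n0 = 16 * k + 2 * j) (hn : 4 * (n0 + 2 * m) ≤ n) :
    Pr p (Bad n) ≤ 2 * (((4 * k + j).choose j) * (1 - (1 - p) ^ (4 * k)) ^ j) +
      4 * (2 : ℝ) ^ (4 * k) * 2 ^ (4 * k) * (1 - p) ^ (k * k) +
      (2 : ℝ) ^ n * 2 ^ n * (1 - p) ^ (k * m) +
      n * ((n.choose (d + 1)) * p ^ (d + 1)) +
      ∑ r ∈ Finset.Icc 1 (n / 4), (n.choose r) * ((1 + n * p) * (1 - p) ^ (n - r - n0 - 1 - d)) ^ r := by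
  classical
  obtain ⟨W, hW, hWt, hWf, hRR⟩ := exists_W (n := n) (4 * k) (4 * k + j) (by omega)
  have hRR' : (RR W).card ≤ n0 := by omega
  have hsub : Bad n ⊆ (((({ω | (NN W true ω).card < 4 * k} ∪ {ω | (NN W false ω).card < 4 * k}) ∪
      (PP W (4 * k) k)ᶜ) ∪ (EE (RR W) k m)ᶜ) ∪
      {ω : Sym2 (Fin n) → Bool | ∀ x, (nb ω Finset.univ x).card ≤ d}ᶜ) ∪
      {ω | ∃ r ∈ Finset.Icc 1 (n / 4), ω ∈ {ω | ∃ Z ∈ (Finset.univ : Finset (Fin n)).powersetCard r, ω ∈ ZZ W d Z}} := by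
    intro ω hω
    by_contra hc
    simp only [Set.mem_union, not_or, Set.mem_compl_iff, not_not] at hc
    obtain ⟨⟨⟨⟨⟨h1, h2⟩, h3⟩, h4⟩, h5⟩, h6⟩ := hc
    refine hω (sparse_det ω W k m d hk hW hWt ?_ h3 h4 (by omega) h5 ?_)
    · rintro (_ | _)
      · exact not_lt.1 h2
      · exact not_lt.1 h1
    · intro Z hZ hZc hmem
      apply h6
      have := hZ.card_pos
      refine ⟨Z.card, Finset.mem_Icc.2 ⟨by omega, by omega⟩, Z, ?_, hmem⟩
      exact Finset.mem_powersetCard.2 ⟨Finset.subset_univ _, rfl⟩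
  have hdis : ∀ b, Disjoint (W b false) (W b true) := by
    intro b
    rw [Finset.disjoint_left]
    intro v h1 h2
    exact absurd (hW _ _ _ _ _ h1 h2).2 (by simp)
  refine (Pr_mono hp hsub).trans ?_
  refine (Pr_union hp _ _).trans (add_le_add ?_ ?_)
  · refine (Pr_union hp _ _).trans (add_le_add ?_ (Pr_deg hp d))
    refine (Pr_union hp _ _).trans (add_le_add ?_ (Pr_EE hp _ k m))
    refine (Pr_union hp _ _).trans (add_le_add ?_ (Pr_PP hp W (4 * k) k hW hWt))
    refine (Pr_union hp _ _).trans ?_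
    rw [two_mul]
    exact add_le_add (Pr_NN hp W true (4 * k) j (hdis _) (hWt _) (hWf _))
      (Pr_NN hp W false (4 * k) j (hdis _) (hWt _) (hWf _))
  · refine (Pr_biUnion hp _ _ _ (fun ω h => h)).trans (Finset.sum_le_sum fun r hr => ?_)
    have := Pr_biUnion_le hp ((Finset.univ : Finset (Fin n)).powersetCard r) (fun Z => ZZ W d Z) _
      (fun ω h => h) (((1 + n * p) * (1 - p) ^ (n - r - n0 - 1 - d)) ^ r) (by
        intro Z hZ
        have hZc := (Finset.mem_powersetCard.1 hZ).2
        have := Pr_CQ hp (Finset.univ \ (Z ∪ RR W)) Z (by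
          rw [Finset.disjoint_left]
          intro v h1 h2
          exact (Finset.mem_sdiff.1 h2).2 (Finset.mem_union_left _ h1)) d (n - r - n0) (by
          have h1 := Finset.le_card_sdiff (Z ∪ RR W) (Finset.univ : Finset (Fin n))
          have h2 := Finset.card_union_le Z (RR W)
          rw [Finset.card_univ, Fintype.card_fin] at h1
          omega)
        rwa [hZc] at this)
    refine this.trans (le_of_eq ?_)
    rw [Finset.card_powersetCard, Finset.card_univ, Fintype.card_fin]

end sparse2
end RFib

namespace RFib

lemma exp_lb {p : ℝ} (h0 : 0 ≤ p) (h1 : p ≤ 1 / 2) : Real.exp (-(2 * p)) ≤ 1 - p := by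
  have h2 := Real.add_one_le_exp (2 * p)
  rw [Real.exp_neg, inv_le_iff_one_le_mul₀ (Real.exp_pos _)]
  nlinarith [Real.exp_pos (2 * p)]

lemma choose_exp (n r : ℕ) (hr : 1 ≤ r) : (n.choose r : ℝ) ≤ (Real.exp 1 * n / r) ^ r := by
  have h1 : (n.choose r : ℝ) ≤ (n : ℝ) ^ r / (r.factorial : ℝ) := Nat.choose_le_pow_div r n
  have h2 := Real.pow_div_factorial_le_exp (r : ℝ) (by positivity) r
  have hr0 : (0 : ℝ) < r := by exact_mod_cast hr
  have hf : (0 : ℝ) < (r.factorial : ℝ) := by exact_mod_cast r.factorial_pos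
  have h3 : Real.exp (r : ℝ) = Real.exp 1 ^ r := by rw [← Real.exp_nat_mul, mul_one]
  rw [div_le_iff₀ hf, h3] at h2
  refine h1.trans ?_
  rw [div_pow, mul_pow, div_le_div_iff₀ hf (by positivity)]
  have : (0 : ℝ) ≤ (n : ℝ) ^ r := by positivity
  nlinarith

lemma q_le_exp {p : ℝ} (hp : p ∈ Set.Icc (0 : ℝ) 1) (m : ℕ) (y : ℝ) (hy : y ≤ p * m) :
    (1 - p) ^ m ≤ Real.exp (-y) := by
  have := pow_le_exp_neg (p := 1 - p) ⟨by linarith [hp.2], by linarith [hp.1]⟩ m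
  refine this.trans (Real.exp_le_exp.2 ?_)
  have : 1 - (1 - p) = p := by ring
  rw [this]; linarith

lemma exp_neg_le_inv {y : ℝ} (hy : 0 < y) : Real.exp (-y) ≤ 1 / y := by
  have := Real.add_one_le_exp y
  rw [Real.exp_neg, ← one_div]
  exact one_div_le_one_div_of_le hy (by linarith)

lemma term1 {p : ℝ} (hp : p ∈ Set.Icc (0 : ℝ) 1) (h2 : p ≤ 1 / 2) (k J : ℕ) (hk : 0 < k)
    (hpk : p * k ≤ 65) (hJ : Real.exp 1 * (1 + J) * Real.exp (-(Real.exp (-520) * J)) ≤ Real.exp (-1)) :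
    ((4 * k + 4 * k * J).choose (4 * k * J) : ℝ) * (1 - (1 - p) ^ (4 * k)) ^ (4 * k * J) ≤
      1 / (4 * k) := by
  set s := 4 * k with hs
  have hs1 : 1 ≤ s := by omega
  have hs0 : (0 : ℝ) < s := by exact_mod_cast hs1
  have hch : ((s + s * J).choose (s * J) : ℝ) ≤ (Real.exp 1 * (1 + J)) ^ s := by
    have e : (s + s * J).choose (s * J) = (s + s * J).choose s := Nat.choose_symm_add.symm
    rw [e]
    refine (choose_exp _ s hs1).trans (le_of_eq ?_)
    congr 1
    push_cast
    field_simp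
  have hθ : Real.exp (-520) ≤ (1 - p) ^ s := by
    calc Real.exp (-520) ≤ Real.exp (-(2 * p)) ^ s := by
          rw [← Real.exp_nat_mul]
          refine Real.exp_le_exp.2 ?_
          rw [hs]; push_cast; nlinarith
      _ ≤ _ := pow_le_pow_left₀ (Real.exp_pos _).le (exp_lb hp.1 h2) s
  have hq : (1 - p) ^ s ≤ 1 := pow_le_one₀ (by linarith [hp.2]) (by linarith [hp.1])
  have hpow : (1 - (1 - p) ^ s) ^ (s * J) ≤ Real.exp (-(Real.exp (-520) * J)) ^ s := by
    have h := q_le_exp (p := (1 - p) ^ s) ⟨(Real.exp_pos _).le.trans hθ, hq⟩ (s * J)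
      (Real.exp (-520) * (s * J : ℕ)) (mul_le_mul_of_nonneg_right hθ (by positivity))
    refine h.trans (le_of_eq ?_)
    rw [← Real.exp_nat_mul]
    congr 1; push_cast; ring
  calc ((s + s * J).choose (s * J) : ℝ) * (1 - (1 - p) ^ s) ^ (s * J)
      ≤ (Real.exp 1 * (1 + J)) ^ s * Real.exp (-(Real.exp (-520) * J)) ^ s :=
        mul_le_mul hch hpow (pow_nonneg (by linarith) _) (by positivity)
    _ = (Real.exp 1 * (1 + J) * Real.exp (-(Real.exp (-520) * J))) ^ s := (mul_pow _ _ _).symm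
    _ ≤ Real.exp (-1) ^ s := pow_le_pow_left₀ (by positivity) hJ _
    _ = Real.exp (-(s : ℝ)) := by rw [← Real.exp_nat_mul]; congr 1; ring
    _ ≤ 1 / s := exp_neg_le_inv hs0
    _ = _ := by rw [hs]; push_cast; rfl

lemma exists_J : ∃ J : ℕ, Real.exp 1 * (1 + J) * Real.exp (-(Real.exp (-520) * J)) ≤ Real.exp (-1) := by
  set θ := Real.exp (-520) with hθ
  have hθ0 : 0 < θ := Real.exp_pos _
  have t0 : Tendsto (fun J : ℕ => θ * (J : ℝ)) atTop atTop :=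
    tendsto_natCast_atTop_atTop.const_mul_atTop hθ0
  have t1 : Tendsto (fun J : ℕ => Real.exp (-(θ * J))) atTop (nhds 0) :=
    Real.tendsto_exp_neg_atTop_nhds_zero.comp t0
  have t2 : Tendsto (fun J : ℕ => (θ * J) ^ 1 * Real.exp (-(θ * J))) atTop (nhds 0) :=
    (Real.tendsto_pow_mul_exp_neg_atTop_nhds_zero 1).comp t0
  have t3 := (t1.const_mul (Real.exp 1)).add (t2.const_mul (Real.exp 1 / θ))
  simp only [mul_zero, add_zero] at t3
  obtain ⟨J, hJ⟩ := (t3.eventually (eventually_le_nhds (Real.exp_pos (-1)))).exists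
  refine ⟨J, le_trans (le_of_eq ?_) hJ⟩
  field_simp

lemma two_le_e : (2 : ℝ) ≤ Real.exp 1 := by
  have := Real.add_one_le_exp (1 : ℝ); linarith

lemma two_pow_le (m : ℕ) : (2 : ℝ) ^ m ≤ Real.exp m := by
  have : Real.exp (m : ℝ) = Real.exp 1 ^ m := by rw [← Real.exp_nat_mul, mul_one]
  rw [this]
  exact pow_le_pow_left₀ (by norm_num) two_le_e m

lemma term2 {p : ℝ} (hp : p ∈ Set.Icc (0 : ℝ) 1) (k : ℕ) (hk : 0 < k) (hpk : 64 ≤ p * k) :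
    4 * (2 : ℝ) ^ (4 * k) * 2 ^ (4 * k) * (1 - p) ^ (k * k) ≤ 4 / k := by
  have hk0 : (0 : ℝ) < k := by exact_mod_cast hk
  have h1 := q_le_exp hp (k * k) (64 * k) (by push_cast; nlinarith)
  have h2 := two_pow_le (4 * k)
  calc 4 * (2 : ℝ) ^ (4 * k) * 2 ^ (4 * k) * (1 - p) ^ (k * k)
      ≤ 4 * Real.exp ((4 * k : ℕ) : ℝ) * Real.exp ((4 * k : ℕ) : ℝ) * Real.exp (-(64 * k)) := by
        refine mul_le_mul ?_ h1 (pow_nonneg (by linarith [hp.2]) _) (by positivity)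
        gcongr
    _ = 4 * Real.exp (-(56 * k)) := by
        rw [mul_assoc, mul_assoc, ← Real.exp_add, ← Real.exp_add]
        congr 2; push_cast; ring
    _ ≤ 4 * Real.exp (-k) := by gcongr; linarith
    _ ≤ 4 * (1 / k) := by gcongr; exact exp_neg_le_inv hk0
    _ = _ := by ring

lemma term3 {p : ℝ} (hp : p ∈ Set.Icc (0 : ℝ) 1) (n k : ℕ) (hpk : 64 ≤ p * k) :
    (2 : ℝ) ^ n * 2 ^ n * (1 - p) ^ (k * (n / 16 + 1)) ≤ Real.exp (-n) := by
  have hm : (n : ℝ) ≤ 16 * ((n / 16 + 1 : ℕ) : ℝ) := by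
    have : n ≤ 16 * (n / 16 + 1) := by omega
    exact_mod_cast this
  have h1 := q_le_exp hp (k * (n / 16 + 1)) (4 * n) (by
    rw [Nat.cast_mul]
    nlinarith [Nat.cast_nonneg (α := ℝ) (n / 16 + 1)])
  have h2 := two_pow_le n
  calc (2 : ℝ) ^ n * 2 ^ n * (1 - p) ^ (k * (n / 16 + 1))
      ≤ Real.exp n * Real.exp n * Real.exp (-(4 * n)) := by
        refine mul_le_mul ?_ h1 (pow_nonneg (by linarith [hp.2]) _) (by positivity)
        gcongr
    _ = Real.exp (-(2 * n)) := by rw [← Real.exp_add, ← Real.exp_add]; congr 1; ring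
    _ ≤ _ := Real.exp_le_exp.2 (by have := Nat.cast_nonneg (α := ℝ) n; linarith)

lemma term4 {p : ℝ} (hp : p ∈ Set.Icc (0 : ℝ) 1) (n d : ℕ) (hn : 0 < n) (hd : 8 * (n * p) ≤ d)
    (hx : Real.log n ≤ n * p) :
    n * ((n.choose (d + 1)) * p ^ (d + 1)) ≤ Real.exp (-(n * p)) := by
  have hn0 : (0 : ℝ) < n := by exact_mod_cast hn
  set x : ℝ := n * p with hxd
  have hx0 : 0 ≤ x := mul_nonneg hn0.le hp.1
  have hf : (0 : ℝ) < ((d + 1).factorial : ℝ) := by exact_mod_cast (d + 1).factorial_pos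
  have h1 : (n.choose (d + 1) : ℝ) ≤ (n : ℝ) ^ (d + 1) / ((d + 1).factorial : ℝ) :=
    Nat.choose_le_pow_div (d + 1) n
  have h2 := Real.pow_div_factorial_le_exp (8 * x) (by positivity) (d + 1)
  have h8 : Real.exp 2 ≤ 8 := by
    have : Real.exp 2 = Real.exp 1 * Real.exp 1 := by rw [← Real.exp_add]; norm_num
    rw [this]
    have := Real.exp_one_lt_d9
    nlinarith [Real.exp_pos 1]
  have h8' : Real.exp (2 * 8 * x) ≤ (8 : ℝ) ^ (d + 1) := by
    calc Real.exp (2 * 8 * x) ≤ Real.exp (((d + 1 : ℕ) : ℝ) * 2) := by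
          refine Real.exp_le_exp.2 ?_; push_cast; linarith
      _ = Real.exp 2 ^ (d + 1) := by rw [Real.exp_nat_mul]
      _ ≤ _ := pow_le_pow_left₀ (Real.exp_pos _).le h8 _
  have h3 : x ^ (d + 1) / ((d + 1).factorial : ℝ) ≤ Real.exp (-(8 * x)) := by
    rw [mul_pow, mul_div_assoc] at h2
    have hy : 0 ≤ x ^ (d + 1) / ((d + 1).factorial : ℝ) := by positivity
    have h4 : Real.exp (2 * 8 * x) * (x ^ (d + 1) / ((d + 1).factorial : ℝ)) ≤ Real.exp (8 * x) :=
      (mul_le_mul_of_nonneg_right h8' hy).trans h2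
    have h5 : Real.exp (8 * x) = Real.exp (2 * 8 * x) * Real.exp (-(8 * x)) := by
      rw [← Real.exp_add]; congr 1; ring
    rw [h5] at h4
    exact le_of_mul_le_mul_left h4 (Real.exp_pos _)
  have hnx : (n : ℝ) ≤ Real.exp x := by
    rw [← Real.exp_log hn0]; exact Real.exp_le_exp.2 hx
  calc (n : ℝ) * ((n.choose (d + 1)) * p ^ (d + 1))
      ≤ Real.exp x * ((n : ℝ) ^ (d + 1) / ((d + 1).factorial : ℝ) * p ^ (d + 1)) := by
        have := hp.1
        gcongr
    _ = Real.exp x * (x ^ (d + 1) / ((d + 1).factorial : ℝ)) := by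
        rw [hxd, mul_pow]; ring
    _ ≤ Real.exp x * Real.exp (-(8 * x)) := by gcongr
    _ = Real.exp (-(7 * x)) := by rw [← Real.exp_add]; congr 1; ring
    _ ≤ _ := Real.exp_le_exp.2 (by linarith)

lemma geom_sum_le {ε : ℝ} (h0 : 0 ≤ ε) (h1 : ε ≤ 1 / 2) (N : ℕ) :
    ∑ r ∈ Finset.Icc 1 N, ε ^ r ≤ 2 * ε - 2 * ε * (1 / 2) ^ N := by
  induction N with
  | zero => simp
  | succ N ih =>
    rw [Finset.sum_Icc_succ_top (by omega)]
    have h2 : ε ^ (N + 1) ≤ ε * (1 / 2) ^ N := by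
      rw [pow_succ, mul_comm]
      exact mul_le_mul_of_nonneg_left (pow_le_pow_left₀ h0 h1 N) h0
    have h3 : (1 / 2 : ℝ) ^ (N + 1) = (1 / 2) ^ N / 2 := by rw [pow_succ]; ring
    rw [h3]
    linarith

lemma term5 {p : ℝ} (hp : p ∈ Set.Icc (0 : ℝ) 1) (n n0 d : ℕ) (K ε : ℝ) (hε0 : 0 ≤ ε) (hε1 : ε ≤ 1 / 2)
    (hK : p * n0 ≤ K) (hd : (d : ℝ) ≤ 8 * (n * p) + 1)
    (hg : ∀ r : ℕ, 1 ≤ r → 4 * r ≤ n → (n / r : ℝ) * (1 + n * p) *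
      Real.exp (-(n * p) + 8 * (n * p) * p + p * r) ≤ ε * Real.exp (-(K + 3))) :
    ∑ r ∈ Finset.Icc 1 (n / 4), (n.choose r) * ((1 + n * p) * (1 - p) ^ (n - r - n0 - 1 - d)) ^ r ≤
      2 * ε := by
  have hp0 := hp.1
  refine (Finset.sum_le_sum fun r hr => ?_).trans ((geom_sum_le hε0 hε1 (n / 4)).trans ?_)
  · obtain ⟨hr1, hr4⟩ := Finset.mem_Icc.1 hr
    have hq0 : 0 ≤ 1 - p := by linarith [hp.2]
    have hsub : (n : ℝ) - r - n0 - 1 - d ≤ ((n - r - n0 - 1 - d : ℕ) : ℝ) := by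
      have : n ≤ (n - r - n0 - 1 - d) + r + n0 + 1 + d := by omega
      have : (n : ℝ) ≤ ((n - r - n0 - 1 - d : ℕ) : ℝ) + r + n0 + 1 + d := by exact_mod_cast this
      linarith
    have hq := q_le_exp hp (n - r - n0 - 1 - d) (n * p - 8 * (n * p) * p - p * r - (K + 2)) (by
      have h1 := mul_le_mul_of_nonneg_left hsub hp0
      have h2 := mul_le_mul_of_nonneg_left hd hp0
      have h3 := hp.2
      nlinarith)
    have hc := choose_exp n r hr1
    have hb0 : 0 ≤ (1 + n * p) * (1 - p) ^ (n - r - n0 - 1 - d) := by positivity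
    refine (mul_le_mul_of_nonneg_right hc (pow_nonneg hb0 _)).trans ?_
    rw [← mul_pow]
    refine pow_le_pow_left₀ (by positivity) ?_ r
    calc Real.exp 1 * n / r * ((1 + n * p) * (1 - p) ^ (n - r - n0 - 1 - d))
        ≤ Real.exp 1 * n / r * ((1 + n * p) * Real.exp (-(n * p - 8 * (n * p) * p - p * r - (K + 2)))) := by
          gcongr
      _ = (n / r : ℝ) * (1 + n * p) * Real.exp (-(n * p) + 8 * (n * p) * p + p * r) * Real.exp (K + 3) := by
          have : Real.exp (-(n * p - 8 * (n * p) * p - p * r - (K + 2))) * Real.exp 1 =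
            Real.exp (-(n * p) + 8 * (n * p) * p + p * r) * Real.exp (K + 3) := by
            rw [← Real.exp_add, ← Real.exp_add]; congr 1; ring
          linear_combination (n / r : ℝ) * (1 + n * p) * this
      _ ≤ ε * Real.exp (-(K + 3)) * Real.exp (K + 3) := by
          exact mul_le_mul_of_nonneg_right (hg r hr1 (by omega)) (Real.exp_pos _).le
      _ = ε := by rw [mul_assoc, ← Real.exp_add]; simp
  · have : 0 ≤ 2 * ε * (1 / 2) ^ (n / 4) := by positivity
    linarith

lemma gbound {p : ℝ} (hp : p ∈ Set.Icc (0 : ℝ) 1) (h64 : p ≤ 1 / 64) (n r : ℕ) (η w : ℝ)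
    (hr : 1 ≤ r) (hrn : 4 * r ≤ n) (hlog : 1 ≤ Real.log n) (hx0 : 0 ≤ (n : ℝ) * p)
    (hw : n * p = Real.log n + Real.log (Real.log n) + w)
    (h32 : 32 * Real.log n ^ 2 ≤ n) (hη1 : 3 * Real.exp 2 * Real.exp (-w) ≤ η)
    (hη2 : Real.exp 1 * ((1 + n * p) ^ 2 * Real.exp (-(3 / 8 * (n * p)))) ≤ η) :
    (n / r : ℝ) * (1 + n * p) * Real.exp (-(n * p) + 8 * (n * p) * p + p * r) ≤ η := by
  have hr0 : (1 : ℝ) ≤ r := by exact_mod_cast hr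
  have hrn' : 4 * (r : ℝ) ≤ n := by exact_mod_cast hrn
  have hn0 : (0 : ℝ) < n := by linarith
  have hp0 := hp.1
  set x : ℝ := n * p with hx
  have e1 : 1 ≤ Real.exp 1 := by linarith [two_le_e]
  have h8 : 8 * x * p ≤ x / 8 := by nlinarith
  by_cases hpr : p * r ≤ 1
  · have hnr : (n / r : ℝ) ≤ n := div_le_self hn0.le hr0
    by_cases hxl : x ≤ 2 * Real.log n
    · have h81 : 8 * x * p ≤ 1 := by
        have h2 : n * (8 * x * p) ≤ n * 1 := by
          have : n * (8 * x * p) = 8 * x ^ 2 := by rw [hx]; ring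
          rw [this]
          nlinarith
        exact le_of_mul_le_mul_left h2 hn0
      have hE : Real.exp (-x) * n = Real.exp (-w) / Real.log n := by
        have hl0 : 0 < Real.log n := by linarith
        rw [eq_div_iff hl0.ne']
        have e2 : Real.exp (-x) * n * Real.log n = Real.exp (-x) * Real.exp (Real.log n) *
            Real.exp (Real.log (Real.log n)) := by rw [Real.exp_log hl0, Real.exp_log hn0]
        rw [e2, ← Real.exp_add, ← Real.exp_add]
        congr 1
        linarith
      calc (n / r : ℝ) * (1 + x) * Real.exp (-x + 8 * x * p + p * r)
          ≤ n * (3 * Real.log n) * Real.exp (-x + 2) := by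
            refine mul_le_mul (mul_le_mul hnr (by linarith) (by linarith) hn0.le)
              (Real.exp_le_exp.2 (by linarith)) (Real.exp_pos _).le (by positivity)
        _ = 3 * Real.exp 2 * (Real.exp (-x) * n * Real.log n) := by rw [Real.exp_add]; ring
        _ = 3 * Real.exp 2 * Real.exp (-w) := by
            rw [hE, div_mul_cancel₀ _ (by linarith)]
        _ ≤ η := hη1
    · push Not at hxl
      have hnx : (n : ℝ) ≤ Real.exp (x / 2) := by
        rw [← Real.exp_log hn0]; exact Real.exp_le_exp.2 (by linarith)
      calc (n / r : ℝ) * (1 + x) * Real.exp (-x + 8 * x * p + p * r)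
          ≤ Real.exp (x / 2) * (1 + x) ^ 2 * Real.exp (-x + x / 8 + 1) := by
            refine mul_le_mul (mul_le_mul (hnr.trans hnx) (by nlinarith) (by linarith) (by positivity))
              (Real.exp_le_exp.2 (by linarith)) (Real.exp_pos _).le (by positivity)
        _ = (1 + x) ^ 2 * (Real.exp (x / 2) * Real.exp (-x + x / 8 + 1)) := by ring
        _ = (1 + x) ^ 2 * (Real.exp 1 * Real.exp (-(3 / 8 * x))) := by
            rw [← Real.exp_add, ← Real.exp_add]; congr 2; ring
        _ = Real.exp 1 * ((1 + x) ^ 2 * Real.exp (-(3 / 8 * x))) := by ring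
        _ ≤ η := hη2
  · push Not at hpr
    have hnr : (n / r : ℝ) ≤ x := by
      rw [div_le_iff₀ (by linarith), hx]; nlinarith
    have hpr4 : p * r ≤ x / 4 := by rw [hx]; nlinarith
    calc (n / r : ℝ) * (1 + x) * Real.exp (-x + 8 * x * p + p * r)
        ≤ (1 + x) * (1 + x) * Real.exp (-(3 / 8 * x)) := by
          refine mul_le_mul (mul_le_mul (by linarith) le_rfl (by linarith) (by linarith))
              (Real.exp_le_exp.2 (by linarith)) (Real.exp_pos _).le (by positivity)
      _ = 1 * ((1 + x) ^ 2 * Real.exp (-(3 / 8 * x))) := by ring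
      _ ≤ Real.exp 1 * ((1 + x) ^ 2 * Real.exp (-(3 / 8 * x))) := by gcongr
      _ ≤ η := hη2

end RFib

namespace RFib

lemma sparse_asym (p : ℕ → ℝ) (hp01 : ∀ n : ℕ, p n ∈ Set.Icc (0 : ℝ) 1)
    (hp1 : Tendsto (fun n : ℕ => n * p n - Real.log n - Real.log (Real.log n)) atTop atTop)
    (δ : ℝ) (hδ : 0 < δ) : ∃ c : ℝ, 0 < c ∧ ∀ᶠ n in atTop, p n ≤ c → Pr (p n) (Bad n) ≤ δ := by
  obtain ⟨J, hJ⟩ := exists_J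
  set K : ℝ := 65 * (16 + 8 * J) with hK
  have hK0 : 0 ≤ K := by positivity
  set ε : ℝ := min (δ / 8) (1 / 2) with hε
  have hε0 : 0 < ε := lt_min (by positivity) (by norm_num)
  set η : ℝ := ε * Real.exp (-(K + 3)) with hη
  have hη0 : 0 < η := by positivity
  refine ⟨min (1 / 64) (δ / 4), lt_min (by norm_num) (by positivity), ?_⟩
  have tl : Tendsto (fun n : ℕ => Real.log n) atTop atTop :=
    Real.tendsto_log_atTop.comp tendsto_natCast_atTop_atTop
  have evl : ∀ᶠ n : ℕ in atTop, 1 ≤ Real.log n := tl.eventually_ge_atTop 1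
  have tx : Tendsto (fun n : ℕ => (n : ℝ) * p n) atTop atTop := by
    refine tendsto_atTop_mono' _ ?_ hp1
    filter_upwards [evl] with n hn
    have := Real.log_nonneg hn
    linarith
  have ev1 : ∀ᶠ n : ℕ in atTop, 3 * Real.exp 2 *
      Real.exp (-(n * p n - Real.log n - Real.log (Real.log n))) ≤ η := by
    have := (Real.tendsto_exp_neg_atTop_nhds_zero.comp hp1).const_mul (3 * Real.exp 2)
    rw [mul_zero] at this
    exact this.eventually (eventually_le_nhds hη0)
  have ev2 : ∀ᶠ n : ℕ in atTop, Real.exp 1 * ((1 + n * p n) ^ 2 *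
      Real.exp (-(3 / 8 * (n * p n)))) ≤ η := by
    have t0 : Tendsto (fun n : ℕ => 3 / 8 * ((n : ℝ) * p n)) atTop atTop :=
      tx.const_mul_atTop (by norm_num)
    have a0 := (Real.tendsto_pow_mul_exp_neg_atTop_nhds_zero 0).comp t0
    have a1 := (Real.tendsto_pow_mul_exp_neg_atTop_nhds_zero 1).comp t0
    have a2 := (Real.tendsto_pow_mul_exp_neg_atTop_nhds_zero 2).comp t0
    have := (((a0.add (a1.const_mul (16 / 3))).add (a2.const_mul (64 / 9)))).const_mul (Real.exp 1)
    simp only [mul_zero, add_zero] at this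
    filter_upwards [this.eventually (eventually_le_nhds hη0)] with n hn
    refine le_trans (le_of_eq ?_) hn
    simp only [Function.comp]
    ring
  have ev3 : ∀ᶠ n : ℕ in atTop, 32 * Real.log n ^ 2 ≤ n := by
    have := (isLittleO_log_rpow_atTop (r := 1 / 2) (by norm_num)).bound (c := 1 / 8) (by positivity)
    have := tendsto_natCast_atTop_atTop.eventually this
    filter_upwards [this, evl] with n hn hl
    have h1 : Real.log n ≤ 1 / 8 * (n : ℝ) ^ (1 / 2 : ℝ) := by
      refine (le_abs_self _).trans ?_
      rw [← Real.norm_eq_abs]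
      refine hn.trans (le_of_eq ?_)
      rw [Real.norm_of_nonneg (by positivity)]
    have h2 : ((n : ℝ) ^ (1 / 2 : ℝ)) ^ 2 = n := by
      rw [← Real.rpow_natCast, ← Real.rpow_mul (by positivity)]; norm_num
    have h3 := pow_le_pow_left₀ (by linarith) h1 2
    rw [mul_pow, h2] at h3
    have : (0 : ℝ) ≤ n := by positivity
    linarith
  have ev4 : ∀ᶠ n : ℕ in atTop, Real.exp (-(n : ℝ)) ≤ δ / 4 :=
    (Real.tendsto_exp_neg_atTop_nhds_zero.comp tendsto_natCast_atTop_atTop).eventually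
      (eventually_le_nhds (by positivity))
  have ev5 : ∀ᶠ n : ℕ in atTop, Real.exp (-((n : ℝ) * p n)) ≤ δ / 4 :=
    (Real.tendsto_exp_neg_atTop_nhds_zero.comp tx).eventually (eventually_le_nhds (by positivity))
  have ev6 := tx.eventually_ge_atTop (8 * K + 16)
  have ev7 := hp1.eventually_ge_atTop 0
  filter_upwards [evl, ev1, ev2, ev3, ev4, ev5, ev6, ev7, eventually_gt_atTop 0] with
    n hl h1 h2 h3 h4 h5 h6 h7 hn hpc
  have hp := hp01 n
  set q := p n with hq
  have h64 : q ≤ 1 / 64 := hpc.trans (min_le_left _ _)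
  have hqδ : q ≤ δ / 4 := hpc.trans (min_le_right _ _)
  have hn0 : (0 : ℝ) < n := by exact_mod_cast hn
  have hq0 : 0 < q := by
    rcases hp.1.lt_or_eq with h | h
    · exact h
    · rw [← h] at h6; linarith
  have hll := Real.log_nonneg hl
  set k : ℕ := ⌈64 / q⌉₊ with hk
  have hk1 : 64 / q ≤ k := Nat.le_ceil _
  have hk2 : (k : ℝ) ≤ 64 / q + 1 := (Nat.ceil_lt_add_one (by positivity)).le
  have hpk1 : 64 ≤ q * k := by
    rw [div_le_iff₀ hq0] at hk1; linarith
  have hpk2 : q * k ≤ 65 := by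
    have := mul_le_mul_of_nonneg_left hk2 hq0.le
    have e : q * (64 / q + 1) = 64 + q := by field_simp
    rw [e] at this; linarith
  have hkpos : 0 < k := Nat.ceil_pos.2 (by positivity)
  have hk0 : (0 : ℝ) < k := by exact_mod_cast hkpos
  set d : ℕ := ⌈8 * (n * q)⌉₊ with hd
  have hd1 : 8 * (n * q) ≤ d := Nat.le_ceil _
  have hd2 : (d : ℝ) ≤ 8 * (n * q) + 1 := (Nat.ceil_lt_add_one (by positivity)).le
  have hpn0 : q * ((16 * k + 2 * (4 * k * J) : ℕ) : ℝ) ≤ K := by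
    push_cast
    have : (0 : ℝ) ≤ 16 + 8 * J := by positivity
    nlinarith
  have hcard : 4 * ((16 * k + 2 * (4 * k * J)) + 2 * (n / 16 + 1)) ≤ n := by
    have a : 8 * ((16 * k + 2 * (4 * k * J) : ℕ) : ℝ) + 16 ≤ n := by
      have : q * (8 * ((16 * k + 2 * (4 * k * J) : ℕ) : ℝ) + 16) ≤ q * n := by nlinarith
      exact le_of_mul_le_mul_left this hq0
    have b : 8 * (16 * k + 2 * (4 * k * J)) + 16 ≤ n := by exact_mod_cast a
    omega
  refine (sparse_bound hp k (4 * k * J) (n / 16 + 1) d _ hkpos rfl hcard).trans ?_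
  have T1 := term1 hp (by linarith) k J hkpos hpk2 hJ
  have T2 := term2 hp k hkpos hpk1
  have T3 := term3 hp n k hpk1
  have T4 := term4 hp n d hn hd1 (by linarith)
  have T5 := term5 hp n (16 * k + 2 * (4 * k * J)) d K ε hε0.le (min_le_right _ _) hpn0 hd2
    (fun r hr hrn => gbound hp h64 n r η _ hr hrn hl (by positivity) (by ring) h3 h1 h2)
  have hεδ : ε ≤ δ / 8 := min_le_left _ _
  have hkq : 1 / (k : ℝ) ≤ q / 64 := by
    rw [div_le_div_iff₀ hk0 (by norm_num)]; linarith
  have e1 : 1 / (4 * (k : ℝ)) = 1 / k / 4 := by field_simp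
  have e2 : 4 / (k : ℝ) = 4 * (1 / k) := by ring
  rw [e1] at T1
  rw [e2] at T2
  linarith

lemma main (p : ℕ → ℝ) (hp01 : ∀ n : ℕ, p n ∈ Set.Icc (0 : ℝ) 1)
    (hp1 : Tendsto (fun n : ℕ => n * p n - Real.log n - Real.log (Real.log n)) atTop atTop)
    (hp2 : Tendsto (fun n : ℕ => (n : ℝ) ^ 2 * (1 - p n)) atTop atTop) :
    Tendsto (fun n : ℕ =>
        erdosRenyi n (p n) {ω | VirtuallyAlgebraicallyFibers (RACG (graphOf ω))})
      atTop (nhds 1) := by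
  have hbad : Tendsto (fun n : ℕ => Pr (p n) (Bad n)) atTop (nhds 0) := by
    rw [Metric.tendsto_atTop']
    intro δ hδ
    obtain ⟨c, hc, ev⟩ := sparse_asym p hp01 hp1 (δ / 2) (by positivity)
    have ev' := dense_asym p hp01 hp2 c hc (δ / 2) (by positivity)
    obtain ⟨N, hN⟩ := eventually_atTop.1 (ev.and ev')
    refine ⟨N, fun n hn => ?_⟩
    have h0 := Pr_nonneg (hp01 n) (Bad n)
    have h1 : Pr (p n) (Bad n) ≤ δ / 2 := by
      rcases le_total (p n) c with h | h
      · exact (hN n hn.le).1 h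
      · exact (hN n hn.le).2 h
    rw [Real.dist_eq, sub_zero, abs_of_nonneg h0]
    linarith
  have hgood : Tendsto (fun n : ℕ => ENNReal.ofReal (1 - Pr (p n) (Bad n))) atTop (nhds 1) := by
    have := ENNReal.tendsto_ofReal (hbad.const_sub 1)
    simpa using this
  refine hgood.congr fun n => ?_
  rw [← Pr_compl, ← pi_eq_Pr (hp01 n), erdosRenyi]
  congr 1
  ext ω
  simp [Bad]

end RFib

theorem aas_racg_virtually_algebraically_fibers (p : ℕ → ℝ)
    (hp01 : ∀ n : ℕ, p n ∈ Set.Icc (0 : ℝ) 1)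
    (hp1 : Tendsto (fun n : ℕ => n * p n - Real.log n - Real.log (Real.log n)) atTop atTop)
    (hp2 : Tendsto (fun n : ℕ => (n : ℝ) ^ 2 * (1 - p n)) atTop atTop) :
    Tendsto (fun n : ℕ =>
        erdosRenyi n (p n) {ω | VirtuallyAlgebraicallyFibers (RACG (graphOf ω))})
      atTop (nhds 1) := by
  exact RFib.main p hp01 hp1 hp2
end

section
/- Let G be a finite simple graph with vertex set V and let H be the complement graph of G. Let F = {{u₁,v₁}, …, {u_k,v_k}} be a maximal matching of H with k ≥ 1, and suppose that there is no vertex v ∈ V such that |N_H(v) ∩ {u_i, v_i}| ≥ 1 for at least ⌈k/2⌉ indices i ∈ {1,…,k}, where N_H(v) is the neighbourhood of v in H. Define S = {u₁, …, u_k}, M_{u_i} = M_{v_i} = {u_i, v_i} for each i ∈ {1,…,k}, and M_v = {v} for each vertex v not covered by F. Then (G, S, 𝓜) is a legal system; in particular G has a legal system. -/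
open SimpleGraph

noncomputable def chi {V : Type*} (A : Set V) : V → ZMod 2 :=
  A.indicator 1

def LegalState {V : Type*} (G : SimpleGraph V) (S : Set V) : Prop :=
  S.Nonempty ∧ Sᶜ.Nonempty ∧ (G.induce S).Connected ∧ (G.induce Sᶜ).Connected

def IsMove {V : Type*} (G : SimpleGraph V) (v : V) (M : Set V) : Prop :=
  v ∈ M ∧ ∀ u ∈ M, ¬ G.Adj v u

noncomputable def actSet {V : Type*} (f : V → ZMod 2) (S : Set V) : Set V :=
  {x | f x + chi S x = 1}

def IsLegalSystem {V : Type*} (G : SimpleGraph V) (S : Set V) (M : V → Set V) : Prop :=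
  (∀ v, IsMove G v (M v)) ∧
    ∀ g ∈ AddSubgroup.closure (Set.range fun v => chi (M v)),
      LegalState G (actSet g S)

def HasLegalSystem {V : Type*} (G : SimpleGraph V) : Prop :=
  ∃ (S : Set V) (M : V → Set V), IsLegalSystem G S M

theorem aux_connected {V : Type*} (G : SimpleGraph V) (k : ℕ) (hk : 1 ≤ k) (u v : Fin k → V)
    (hedge : ∀ i : Fin k, Gᶜ.Adj (u i) (v i))
    (hstar : ¬ ∃ w : V, (k + 1) / 2 ≤
      {i : Fin k | Gᶜ.Adj w (u i) ∨ Gᶜ.Adj w (v i)}.ncard)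
    (T : Set V) (hT : ∀ i, u i ∈ T ∨ v i ∈ T) :
    T.Nonempty ∧ (G.induce T).Connected := by
  have hne : T.Nonempty := by
    rcases hT ⟨0, hk⟩ with h | h
    · exact ⟨_, h⟩
    · exact ⟨_, h⟩
  have key : ∀ a b : V, ∃ t ∈ T, G.Adj a t ∧ G.Adj b t := by
    intro a b
    have hB : ∃ i : Fin k, i ∉ {i : Fin k | Gᶜ.Adj a (u i) ∨ Gᶜ.Adj a (v i)} ∪
        {i : Fin k | Gᶜ.Adj b (u i) ∨ Gᶜ.Adj b (v i)} := by
      by_contra hcon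
      push Not at hcon
      have h1 := Set.ncard_union_le {i : Fin k | Gᶜ.Adj a (u i) ∨ Gᶜ.Adj a (v i)}
        {i : Fin k | Gᶜ.Adj b (u i) ∨ Gᶜ.Adj b (v i)}
      rw [Set.eq_univ_of_forall hcon, Set.ncard_univ, Nat.card_fin] at h1
      push Not at hstar
      have h2 := hstar a
      have h3 := hstar b
      omega
    obtain ⟨i, hi⟩ := hB
    simp only [Set.mem_union, Set.mem_setOf_eq, not_or] at hi
    obtain ⟨⟨h1, h2⟩, h3, h4⟩ := hi
    have gen : ∀ x, ¬ Gᶜ.Adj x (u i) → ¬ Gᶜ.Adj x (v i) → G.Adj x (u i) ∧ G.Adj x (v i) := by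
      intro x hu hv
      have hxu : x ≠ u i := by
        rintro rfl
        exact hv (hedge i)
      have hxv : x ≠ v i := by
        rintro rfl
        exact hu (hedge i).symm
      rw [SimpleGraph.compl_adj] at hu hv
      constructor
      · by_contra h
        exact hu ⟨hxu, h⟩
      · by_contra h
        exact hv ⟨hxv, h⟩
    rcases hT i with h | h
    · exact ⟨_, h, (gen a h1 h2).1, (gen b h3 h4).1⟩
    · exact ⟨_, h, (gen a h1 h2).2, (gen b h3 h4).2⟩
  refine ⟨hne, ?_⟩
  haveI : Nonempty T := hne.to_subtype
  refine SimpleGraph.Connected.mk ?_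
  intro a b
  obtain ⟨t, ht, hat, hbt⟩ := key a b
  have e1 : (G.induce T).Adj a ⟨t, ht⟩ := hat
  have e2 : (G.induce T).Adj b ⟨t, ht⟩ := hbt
  exact e1.reachable.trans e2.reachable.symm

theorem matching_legal_system {V : Type*} [Fintype V] [DecidableEq V]
    (G : SimpleGraph V) (k : ℕ) (hk : 1 ≤ k) (u v : Fin k → V)
    -- the edges {uᵢ, vᵢ} are pairwise disjoint
    (hinj : Function.Injective fun x : Fin k × Bool => if x.2 then u x.1 else v x.1)
    -- each {uᵢ, vᵢ} is an edge of the complement H = Gᶜ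
    (hedge : ∀ i : Fin k, Gᶜ.Adj (u i) (v i))
    -- the matching is maximal: every edge of H meets a matched vertex
    (hmax : ∀ a b : V, Gᶜ.Adj a b →
      ∃ i : Fin k, a = u i ∨ a = v i ∨ b = u i ∨ b = v i)
    -- no vertex is H-adjacent to at least ⌈k/2⌉ of the matching edges
    (hstar : ¬ ∃ w : V, (k + 1) / 2 ≤
      {i : Fin k | Gᶜ.Adj w (u i) ∨ Gᶜ.Adj w (v i)}.ncard) :
    IsLegalSystem G (Set.range u)
        (fun x => {y | y = x ∨ ∃ i : Fin k, (x = u i ∨ x = v i) ∧ (y = u i ∨ y = v i)}) ∧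
      HasLegalSystem G := by
  have huv : ∀ i j, u i ≠ v j := by
    intro i j h
    have := @hinj (i, true) (j, false) (by simpa using h)
    simp at this
  have hu : Function.Injective u := by
    intro i j h
    have := @hinj (i, true) (j, true) (by simpa using h)
    simpa using this
  have hv : Function.Injective v := by
    intro i j h
    have := @hinj (i, false) (j, false) (by simpa using h)
    simpa using this
  have main : IsLegalSystem G (Set.range u)
        (fun x => {y | y = x ∨ ∃ i : Fin k, (x = u i ∨ x = v i) ∧ (y = u i ∨ y = v i)}) := by
    refine ⟨?_, ?_⟩
    · intro x
      refine ⟨Or.inl rfl, ?_⟩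
      rintro y (rfl | ⟨i, hx, hy⟩)
      · exact G.loopless.irrefl _
      · have h := ((SimpleGraph.compl_adj _ _ _).1 (hedge i)).2
        rcases hx with rfl | rfl <;> rcases hy with rfl | rfl
        · exact G.loopless.irrefl _
        · exact h
        · exact fun h' => h h'.symm
        · exact G.loopless.irrefl _
    · intro g hg
      have inv : ∀ i, g (u i) = g (v i) := by
        intro i
        induction hg using AddSubgroup.closure_induction with
        | mem x hx =>
          obtain ⟨w, rfl⟩ := hx
          have : (u i ∈ {y | y = w ∨ ∃ i : Fin k, (w = u i ∨ w = v i) ∧ (y = u i ∨ y = v i)}) ↔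
              (v i ∈ {y | y = w ∨ ∃ i : Fin k, (w = u i ∨ w = v i) ∧ (y = u i ∨ y = v i)}) := by
            constructor
            · rintro (h | ⟨j, h1, h2 | h2⟩)
              · exact Or.inr ⟨i, Or.inl h.symm, Or.inr rfl⟩
              · rw [hu h2]
                exact Or.inr ⟨j, h1, Or.inr rfl⟩
              · exact absurd h2 (huv _ _)
            · rintro (h | ⟨j, h1, h2 | h2⟩)
              · exact Or.inr ⟨i, Or.inr h.symm, Or.inl rfl⟩
              · exact absurd h2.symm (huv _ _)
              · rw [hv h2]
                exact Or.inr ⟨j, h1, Or.inl rfl⟩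
          classical
          simp only [chi, Set.indicator_apply, this, Pi.one_apply]
        | zero => rfl
        | add x y _ _ hx hy => simp [hx, hy]
        | neg x _ hx => simp [hx]
      have cu : ∀ i, chi (Set.range u) (u i) = 1 := by
        intro i
        simp [chi]
      have cv : ∀ i, chi (Set.range u) (v i) = 0 := by
        intro i
        simp [chi, huv]
      have z : ∀ c : ZMod 2, c = 0 ∨ c = 1 := by decide
      have h11 : (1 + 1 : ZMod 2) ≠ 1 := by decide
      have h1 := aux_connected G k hk u v hedge hstar (actSet g (Set.range u)) (by
        intro i
        simp only [actSet, Set.mem_setOf_eq, cu, cv, inv]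
        rcases z (g (v i)) with h | h <;> simp [h])
      have h2 := aux_connected G k hk u v hedge hstar (actSet g (Set.range u))ᶜ (by
        intro i
        simp only [actSet, Set.mem_compl_iff, Set.mem_setOf_eq, cu, cv, inv]
        rcases z (g (v i)) with h | h <;> simp [h])
      exact ⟨h1.1, h2.1, h1.2, h2.2⟩
  exact ⟨main, _, _, main⟩
end
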